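/- arXiv:1507.00547 — 7 statements merged into one kernel-verified Lean document; each statement's English description precedes it below -/
import Mathlib

section
/- Let r ≥ 2 be an integer. Every graph G with m edges contains a subgraph which has no copy of K_{r,r} and has at least (1/4)·m^{r/(r+1)} edges. -/
/-- `{A, B}` is a copy of `K_{r,r}` in `G`: `A` and `B` are disjoint `r`-element vertex
sets and every pair `(a, b)` with `a ∈ A`, `b ∈ B` is an edge of `G`. -/
def IsKrrCopy {V : Type*} (G : SimpleGraph V) (r : ℕ) (A B : Finset V) : Prop :=
  A.card = r ∧ B.card = r ∧ Disjoint A B ∧ ∀ a ∈ A, ∀ b ∈ B, G.Adj a b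

open Finset in
/-- A `p`-random subset of `E` contains a fixed set `T ⊆ E` with probability `p ^ #T`. -/
lemma sum_powerset_weight_of_subset {α : Type*} [DecidableEq α] (E T : Finset α) (hT : T ⊆ E)
    (p : ℝ) :
    ∑ S ∈ E.powerset, (p ^ #S * (1 - p) ^ #(E \ S)) * (if T ⊆ S then 1 else 0) = p ^ #T := by
  have h := Finset.prod_add (fun _ : α => p) (fun i => if i ∈ T then 0 else 1 - p) E
  have hl : ∏ i ∈ E, (p + if i ∈ T then 0 else 1 - p) = p ^ #T := by
    have : ∀ i ∈ E, (p + if i ∈ T then 0 else 1 - p) = if i ∈ T then p else 1 := by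
      intro i _
      split_ifs <;> ring
    rw [Finset.prod_congr rfl this, Finset.prod_ite_mem, Finset.inter_eq_right.mpr hT,
      Finset.prod_const]
  rw [← hl, h]
  refine Finset.sum_congr rfl fun S _ => ?_
  rw [Finset.prod_const, mul_assoc]
  congr 1
  split_ifs with hTS
  · rw [mul_one, ← Finset.prod_const]
    refine Finset.prod_congr rfl fun i hi => ?_
    rw [if_neg fun hiT => (Finset.mem_sdiff.mp hi).2 (hTS hiT)]
  · obtain ⟨i, hiT, hiS⟩ := Finset.not_subset.mp hTS
    rw [mul_zero, Finset.prod_eq_zero (Finset.mem_sdiff.mpr ⟨hT hiT, hiS⟩)]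
    exact if_pos hiT

open Finset in
/-- Some subset `S` of `E` does at least as well as a `p`-random one for the size of `S` minus
the number of members of the family `F` contained in `S`. -/
lemma exists_subset_card_sub_ge {α ι : Type*} [DecidableEq α] (E : Finset α) (P : Finset ι)
    (F : ι → Finset α) (hF : ∀ i ∈ P, F i ⊆ E) (p : ℝ) (hp0 : 0 ≤ p) (hp1 : p ≤ 1) :
    ∃ S ⊆ E, p * #E - ∑ i ∈ P, p ^ #(F i) ≤ (#S : ℝ) - #{i ∈ P | F i ⊆ S} := by
  set w : Finset α → ℝ := fun S => p ^ #S * (1 - p) ^ #(E \ S) with hw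
  have hw0 : ∀ S, 0 ≤ w S := fun S =>
    mul_nonneg (pow_nonneg hp0 _) (pow_nonneg (sub_nonneg.mpr hp1) _)
  have key := sum_powerset_weight_of_subset E
  have hw1 : ∑ S ∈ E.powerset, w S = 1 := by
    simpa using key ∅ (Finset.empty_subset _) p
  have hcard : ∑ S ∈ E.powerset, w S * (#S : ℝ) = p * #E := by
    have : ∀ S ∈ E.powerset, w S * (#S : ℝ) = ∑ e ∈ E, w S * (if {e} ⊆ S then 1 else 0) := by
      intro S hS
      rw [← Finset.mul_sum]
      simp [Finset.inter_eq_right.mpr (Finset.mem_powerset.mp hS)]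
    rw [Finset.sum_congr rfl this, Finset.sum_comm,
      Finset.sum_congr rfl fun e he => key {e} (Finset.singleton_subset_iff.mpr he) p]
    simp [mul_comm]
  have hbad : ∑ S ∈ E.powerset, w S * (#{i ∈ P | F i ⊆ S} : ℝ) = ∑ i ∈ P, p ^ #(F i) := by
    have : ∀ S ∈ E.powerset,
        w S * (#{i ∈ P | F i ⊆ S} : ℝ) = ∑ i ∈ P, w S * (if F i ⊆ S then 1 else 0) := by
      intro S _
      rw [← Finset.mul_sum, Finset.sum_boole]
    rw [Finset.sum_congr rfl this, Finset.sum_comm,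
      Finset.sum_congr rfl fun i hi => key (F i) (hF i hi) p]
  by_contra! hcon
  set c : ℝ := p * #E - ∑ i ∈ P, p ^ #(F i) with hc
  have hle : ∀ S ∈ E.powerset, w S * ((#S : ℝ) - #{i ∈ P | F i ⊆ S}) ≤ w S * c := fun S hS =>
    mul_le_mul_of_nonneg_left (hcon S (Finset.mem_powerset.mp hS)).le (hw0 S)
  have htot : ∑ S ∈ E.powerset, w S * ((#S : ℝ) - #{i ∈ P | F i ⊆ S})
      = ∑ S ∈ E.powerset, w S * c := by
    simp only [mul_sub (w _), Finset.sum_sub_distrib, hcard, hbad, ← Finset.sum_mul, hw1, hc,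
      one_mul]
  have heq := (Finset.sum_eq_sum_iff_of_le hle).mp htot
  have hzero : ∀ S ∈ E.powerset, w S = 0 := by
    intro S hS
    by_contra h
    exact (hcon S (Finset.mem_powerset.mp hS)).ne (mul_left_cancel₀ h (heq S hS))
  rw [Finset.sum_eq_zero hzero] at hw1
  exact zero_ne_one hw1

open Finset in
/-- A graph with `m` edges has at most `(2m)^r` ordered copies of `K_{r,r}`, since each is
determined by an `r`-tuple of darts. -/
lemma card_isKrrCopy_le {V : Type*} [Fintype V] (G : SimpleGraph V) (r : ℕ)
    (P : Finset (Finset V × Finset V)) (hP : ∀ x ∈ P, IsKrrCopy G r x.1 x.2) :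
    #P ≤ (2 * G.edgeSet.ncard) ^ r := by
  classical
  have hsub : P ⊆ (univ : Finset (Fin r → G.Dart)).image
      fun d => (univ.image fun i => (d i).fst, univ.image fun i => (d i).snd) := by
    rintro ⟨A, B⟩ hx
    obtain ⟨hA, hB, -, hadj⟩ := hP _ hx
    let f := A.equivFinOfCardEq hA
    let g := B.equivFinOfCardEq hB
    refine mem_image.mpr ⟨fun i => ⟨((f.symm i : V), (g.symm i : V)),
      hadj _ (f.symm i).2 _ (g.symm i).2⟩, mem_univ _, ?_⟩
    ext v
    · simp only [mem_image, mem_univ, true_and]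
      exact ⟨fun ⟨i, hi⟩ => hi ▸ (f.symm i).2, fun hv => ⟨f ⟨v, hv⟩, by simp⟩⟩
    · simp only [mem_image, mem_univ, true_and]
      exact ⟨fun ⟨i, hi⟩ => hi ▸ (g.symm i).2, fun hv => ⟨g ⟨v, hv⟩, by simp⟩⟩
  refine (card_le_card hsub).trans (card_image_le.trans ?_)
  rw [card_univ, Fintype.card_fun, Fintype.card_fin, G.dart_card_eq_twice_card_edges,
    ← SimpleGraph.coe_edgeFinset, Set.ncard_coe_finset]

open Finset in
/-- Disjoint sets `A` and `B` span `#A * #B` potential edges. -/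
lemma card_image_mk_product {V : Type*} [DecidableEq V] {A B : Finset V} (h : Disjoint A B) :
    #((A ×ˢ B).image fun x => s(x.1, x.2)) = #A * #B := by
  rw [card_image_of_injOn, card_product]
  rintro ⟨a, b⟩ hx ⟨c, d⟩ hy hxy
  simp only [coe_product, Set.mem_prod, mem_coe] at hx hy
  rcases Sym2.eq_iff.mp hxy with ⟨rfl, rfl⟩ | ⟨rfl, rfl⟩
  · rfl
  · exact absurd hy.2 (disjoint_left.mp h hx.1)

open Finset in
/-- The deletion method for `K_{r,r}`-free subgraphs. -/
lemma exists_krrFree_subgraph {V : Type*} [Fintype V] (r : ℕ) (hr : r ≠ 0) (G : SimpleGraph V)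
    (p : ℝ) (hp0 : 0 ≤ p) (hp1 : p ≤ 1) :
    ∃ G' : SimpleGraph V, G' ≤ G ∧ (∀ A B : Finset V, ¬ IsKrrCopy G' r A B) ∧
      p * G.edgeSet.ncard - (2 * G.edgeSet.ncard : ℝ) ^ r * p ^ (r * r) ≤
        (G'.edgeSet.ncard : ℝ) := by
  classical
  let P : Finset (Finset V × Finset V) := {x | IsKrrCopy G r x.1 x.2}
  let F : Finset V × Finset V → Finset (Sym2 V) := fun x =>
    (x.1 ×ˢ x.2).image fun y => s(y.1, y.2)
  have hP : ∀ x ∈ P, IsKrrCopy G r x.1 x.2 := fun x hx => (mem_filter.mp hx).2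
  have hF : ∀ x ∈ P, F x ⊆ G.edgeFinset := by
    intro x hx e he
    obtain ⟨y, hy, rfl⟩ := mem_image.mp he
    rw [mem_product] at hy
    simpa using (hP x hx).2.2.2 _ hy.1 _ hy.2
  have hFcard : ∀ x ∈ P, #(F x) = r * r := fun x hx => by
    obtain ⟨hA, hB, hAB, -⟩ := hP x hx
    rw [card_image_mk_product hAB, hA, hB]
  have hFne : ∀ x ∈ P, ∃ D ⊆ F x, #D = 1 := fun x hx =>
    exists_subset_card_eq (by rw [hFcard x hx]; exact Nat.mul_pos (by omega) (by omega))
  choose! D hDF hD using hFne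
  obtain ⟨S, hSE, hS⟩ := exists_subset_card_sub_ge G.edgeFinset P F hF p hp0 hp1
  let R : Finset (Sym2 V) := S \ Finset.biUnion {x ∈ P | F x ⊆ S} D
  have hRE : R ⊆ G.edgeFinset := sdiff_subset.trans hSE
  have hedge : (SimpleGraph.fromEdgeSet (R : Set (Sym2 V))).edgeSet = R := by
    rw [SimpleGraph.edgeSet_fromEdgeSet, sdiff_eq_left, Set.disjoint_left]
    intro x hx hd
    exact G.not_isDiag_of_mem_edgeSet (SimpleGraph.mem_edgeFinset.mp (hRE hx)) hd
  have hle : SimpleGraph.fromEdgeSet (R : Set (Sym2 V)) ≤ G := by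
    rw [← SimpleGraph.edgeSet_subset_edgeSet, hedge]
    exact fun x hx => SimpleGraph.mem_edgeFinset.mp (hRE hx)
  refine ⟨_, hle, ?_, ?_⟩
  · rintro A B ⟨hA, hB, hAB, hadj⟩
    have hmem : (A, B) ∈ P :=
      mem_filter.mpr ⟨mem_univ _, hA, hB, hAB, fun a ha b hb => hle (hadj a ha b hb)⟩
    have hFR : F (A, B) ⊆ R := by
      intro x hx
      obtain ⟨y, hy, rfl⟩ := mem_image.mp hx
      rw [mem_product] at hy
      have := hadj _ hy.1 _ hy.2
      rwa [← SimpleGraph.mem_edgeSet, hedge, mem_coe] at this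
    have hbad : (A, B) ∈ ({x ∈ P | F x ⊆ S} : Finset _) :=
      mem_filter.mpr ⟨hmem, hFR.trans sdiff_subset⟩
    obtain ⟨x, hx⟩ := card_pos.mp ((hD _ hmem).symm ▸ one_pos)
    exact (mem_sdiff.mp (hFR (hDF _ hmem hx))).2 (mem_biUnion.mpr ⟨_, hbad, hx⟩)
  · rw [hedge, Set.ncard_coe_finset]
    have hR : (#S : ℝ) - #{x ∈ P | F x ⊆ S} ≤ #R := by
      have h1 := le_card_sdiff (Finset.biUnion {x ∈ P | F x ⊆ S} D) S
      have h2 : #(Finset.biUnion {x ∈ P | F x ⊆ S} D) ≤ #{x ∈ P | F x ⊆ S} := by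
        simpa using card_biUnion_le_card_mul _ D 1 fun x hx =>
          (hD x (mem_filter.mp hx).1).le
      have h3 : #S ≤ #R + #{x ∈ P | F x ⊆ S} := by
        change _ ≤ #R at h1
        omega
      rw [sub_le_iff_le_add]
      exact_mod_cast h3
    have hN : (#P : ℝ) ≤ (2 * G.edgeSet.ncard : ℝ) ^ r := by
      exact_mod_cast card_isKrrCopy_le G r P hP
    have hm : (#G.edgeFinset : ℝ) = G.edgeSet.ncard := by
      rw [← SimpleGraph.coe_edgeFinset, Set.ncard_coe_finset]
    rw [sum_congr rfl fun x hx => by rw [hFcard x hx], sum_const, nsmul_eq_mul, hm] at hS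
    have := mul_le_mul_of_nonneg_right hN (pow_nonneg hp0 (r * r))
    linarith

/-- **Large `K_{r,r}`-free subgraphs.** Let `r ≥ 2`. Every graph `G` with `m` edges
contains a `K_{r,r}`-free subgraph with at least `(1/4) m^{r/(r+1)}` edges. -/
theorem stmt4 {V : Type*} [Fintype V] (r : ℕ) (hr : 2 ≤ r) (G : SimpleGraph V) (m : ℕ)
    (hm : G.edgeSet.ncard = m) :
    ∃ G' : SimpleGraph V, G' ≤ G ∧ (∀ A B : Finset V, ¬ IsKrrCopy G' r A B) ∧
      (1 / 4 : ℝ) * (m : ℝ) ^ ((r : ℝ) / (r + 1)) ≤ (G'.edgeSet.ncard : ℝ) := by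
  rcases Nat.eq_zero_or_pos m with rfl | hpos
  · obtain ⟨G', hG', hfree, -⟩ :=
      exists_krrFree_subgraph r (by omega) G 0 le_rfl zero_le_one
    refine ⟨G', hG', hfree, ?_⟩
    rw [Nat.cast_zero, Real.zero_rpow (by positivity), mul_zero]
    positivity
  have hm1 : (1 : ℝ) ≤ m := by exact_mod_cast hpos
  have hm0 : (0 : ℝ) < m := by linarith
  have hr1 : (r : ℝ) + 1 ≠ 0 := by positivity
  set q : ℝ := (m : ℝ) ^ (-(1 / ((r : ℝ) + 1))) with hq
  have hq0 : 0 < q := Real.rpow_pos_of_pos hm0 _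
  have hq1 : q ≤ 1 := Real.rpow_le_one_of_one_le_of_nonpos hm1 (neg_nonpos.mpr (by positivity))
  have hmq : (m : ℝ) ^ ((r : ℝ) / (r + 1)) = m * q := by
    have hexp : 1 + -(1 / ((r : ℝ) + 1)) = r / (r + 1) := by
      field_simp
      ring
    rw [hq, ← Real.rpow_one_add' hm0.le (by rw [hexp]; positivity), hexp]
  have hqpow : m * q ^ (r + 1) = 1 := by
    rw [hq, ← Real.rpow_natCast, ← Real.rpow_mul hm0.le]
    push_cast
    rw [neg_mul, one_div_mul_cancel hr1, Real.rpow_neg_one, mul_inv_cancel₀ hm0.ne']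
  obtain ⟨G', hG', hfree, hcard⟩ := exists_krrFree_subgraph r (by omega) G (q / 2)
    (by positivity) (by linarith)
  refine ⟨G', hG', hfree, le_trans ?_ hcard⟩
  rw [hm, hmq]
  obtain ⟨k, rfl⟩ : ∃ k, r = k + 2 := ⟨r - 2, by omega⟩
  have hcopies : (m : ℝ) ^ (k + 2) * q ^ ((k + 2) * (k + 2)) = m * q := by
    calc (m : ℝ) ^ (k + 2) * q ^ ((k + 2) * (k + 2))
        = (m * q ^ (k + 2 + 1)) ^ (k + 1) * (m * q) := by ring
      _ = m * q := by rw [hqpow, one_pow, one_mul]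
  have htwo : (2 : ℝ) ^ (k + 2) * 4 ≤ 2 ^ ((k + 2) * (k + 2)) := by
    rw [show (4 : ℝ) = 2 ^ 2 by norm_num, ← pow_add]
    exact pow_le_pow_right₀ one_le_two (by nlinarith)
  have hbound : (2 * m : ℝ) ^ (k + 2) * (q / 2) ^ ((k + 2) * (k + 2)) ≤ m * q / 4 := by
    rw [mul_pow, div_pow, mul_assoc, ← mul_div_assoc, hcopies, ← mul_div_assoc,
      div_le_div_iff₀ (by positivity) (by norm_num)]
    nlinarith [mul_le_mul_of_nonneg_left htwo (mul_pos hm0 hq0).le]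
  linarith
end

section
/- Let k ≥ 2 and r ≥ 2 be integers, q = (r^k − 1)/(r − 1), and n ≥ r an integer. Let G be the complete k-partite k-graph with parts U₁, ..., U_k where |U_i| = n^{r^{i−1}}, so that G has m = n^q edges. Then every subhypergraph of G which has no copy of K^{(k)}_{r,...,r} has at most (r + k − 2)·n^{q−1} = (r + k − 2)·m^{(q−1)/q} edges. -/
/-- A copy of the complete `k`-partite `k`-graph `K^{(k)}_{r,…,r}` in the `k`-uniform
hypergraph `G`: `k` pairwise disjoint `r`-element vertex sets `S 0, …, S (k-1)` such that
every set `{s₁, …, s_k}` with `s_i ∈ S i` for each `i` is an edge of `G`. -/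
def HasKrrrCopy {α : Type*} [DecidableEq α] (G : Finset (Finset α)) (k r : ℕ) : Prop :=
  ∃ S : Fin k → Finset α, (∀ i, (S i).card = r) ∧
    (∀ i j, i ≠ j → Disjoint (S i) (S j)) ∧
    ∀ g : Fin k → α, (∀ i, g i ∈ S i) → Finset.image g Finset.univ ∈ G

/-- The choices of an `r`-subset `S i` of each part `U i` such that every transversal of `S` lies
in `E`. -/
def transversalCopies {α : Type*} [DecidableEq α] {k : ℕ} (r : ℕ) (U : Fin k → Finset α)
    (E : Finset (Fin k → α)) : Finset (Fin k → Finset α) :=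
  {S ∈ Fintype.piFinset fun i => (U i).powersetCard r | Fintype.piFinset S ⊆ E}

/-- An upper bound, in terms of the part sizes `N 0, …, N (k - 1)`, on the number of edges of a
`k`-partite `k`-graph without a copy of `K^{(k)}_{r,…,r}`. -/
def partiteTuranBound (N : ℕ → ℕ) (r : ℕ) : ℕ → ℕ
  | 0 => 0
  | k + 1 => N k * partiteTuranBound N r k + (r - 1) * ∏ i ∈ Finset.range k, (N i).choose r

theorem mem_transversalCopies {α : Type*} [DecidableEq α] {k r : ℕ} {U : Fin k → Finset α}
    {E : Finset (Fin k → α)} {S : Fin k → Finset α} :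
    S ∈ transversalCopies r U E ↔
      (∀ i, S i ⊆ U i ∧ (S i).card = r) ∧ Fintype.piFinset S ⊆ E := by
  simp [transversalCopies, Finset.mem_powersetCard]

/-- Deleting one edge from each copy turns a bound for copy-free families into a lower bound on
the number of copies. -/
theorem card_le_add_card_transversalCopies {α : Type*} [DecidableEq α] {k r b : ℕ} (hr : 0 < r)
    {U : Fin k → Finset α}
    (hb : ∀ E ⊆ Fintype.piFinset U, transversalCopies r U E = ∅ → E.card ≤ b)
    (E : Finset (Fin k → α)) (hE : E ⊆ Fintype.piFinset U) :
    E.card ≤ b + (transversalCopies r U E).card := by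
  induction E using Finset.strongInduction with
  | H E ih =>
    rcases (transversalCopies r U E).eq_empty_or_nonempty with h | ⟨S, hS⟩
    · simpa [h] using hb E hE h
    · have hS' := mem_transversalCopies.1 hS
      obtain ⟨e, he⟩ : (Fintype.piFinset S).Nonempty := by
        rw [Fintype.piFinset_nonempty]
        intro i
        rw [← Finset.card_pos, (hS'.1 i).2]
        exact hr
      have heE : e ∈ E := hS'.2 he
      have h1 := ih _ (Finset.erase_ssubset heE) ((Finset.erase_subset _ _).trans hE)
      have h2 : transversalCopies r U (E.erase e) ⊂ transversalCopies r U E := by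
        rw [Finset.ssubset_iff_of_subset]
        · refine ⟨S, hS, fun h => ?_⟩
          exact Finset.notMem_erase e E ((mem_transversalCopies.1 h).2 he)
        · intro T hT
          rw [mem_transversalCopies] at hT ⊢
          exact ⟨hT.1, hT.2.trans (Finset.erase_subset _ _)⟩
      have h3 := Finset.card_lt_card h2
      have h4 := Finset.card_erase_add_one heE
      omega

open Finset in
theorem card_le_partiteTuranBound_add {α : Type*} [DecidableEq α] {r : ℕ} (hr : 0 < r)
    (N : ℕ → ℕ) (k : ℕ) (U : Fin k → Finset α) (hU : ∀ i, (U i).card = N i)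
    (E : Finset (Fin k → α)) (hE : E ⊆ Fintype.piFinset U) :
    E.card ≤ partiteTuranBound N r k + (transversalCopies r U E).card := by
  induction k with
  | zero =>
    refine card_le_add_card_transversalCopies hr (fun E _ h => ?_) E hE
    rw [partiteTuranBound, Nat.le_zero, card_eq_zero]
    by_contra hne
    obtain ⟨e, he⟩ := nonempty_iff_ne_empty.2 hne
    have : (fun _ => ∅ : Fin 0 → Finset α) ∈ transversalCopies r U E := by
      rw [mem_transversalCopies]
      exact ⟨fun i => i.elim0, fun g _ => by rwa [Subsingleton.elim g e]⟩
    simp [h] at this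
  | succ k ih =>
    refine card_le_add_card_transversalCopies hr (fun E hE h => ?_) E hE
    set V : Fin k → Finset α := fun i => U i.castSucc with hV
    set L : α → Finset (Fin k → α) := fun v =>
      {g ∈ Fintype.piFinset V | (Fin.snoc g v : Fin (k + 1) → α) ∈ E} with hL
    set W := U (Fin.last k) with hW
    have hfib : E.card ≤ ∑ v ∈ W, (L v).card := by
      rw [card_eq_sum_card_fiberwise (f := fun e => e (Fin.last k)) (t := W)
        (fun e he => Fintype.mem_piFinset.1 (hE he) _)]
      refine sum_le_sum fun v _ => ?_
      refine card_le_card_of_injOn (fun e => Fin.init e) (fun e he => ?_) ?_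
      · obtain ⟨heE, rfl⟩ := mem_filter.1 he
        refine mem_filter.2 ⟨Fintype.mem_piFinset.2 fun i => ?_, ?_⟩
        · exact Fintype.mem_piFinset.1 (hE heE) _
        · rwa [Fin.snoc_init_self]
      · intro e he f hf hef
        rw [← Fin.snoc_init_self e, ← Fin.snoc_init_self f]
        rw [mem_coe, mem_filter] at he hf
        simp only at hef
        rw [hef, he.2, hf.2]
    have hlink : ∀ v ∈ W, (L v).card ≤
        partiteTuranBound N r k + (transversalCopies r V (L v)).card := fun v _ =>
      ih V (fun i => hU i.castSucc) (L v) (filter_subset _ _)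
    have hcount : ∑ v ∈ W, (transversalCopies r V (L v)).card ≤
        (r - 1) * ∏ i ∈ range k, (N i).choose r := by
      have hdouble : ∑ v ∈ W, (transversalCopies r V (L v)).card =
          ∑ S ∈ Fintype.piFinset fun i => (V i).powersetCard r,
            #{v ∈ W | Fintype.piFinset S ⊆ L v} :=
        sum_card_bipartiteAbove_eq_sum_card_bipartiteBelow
          (fun v S => Fintype.piFinset S ⊆ L v)
      have hcard : #(Fintype.piFinset fun i => (V i).powersetCard r) =
          ∏ i ∈ range k, (N i).choose r := by
        rw [Fintype.card_piFinset, prod_range]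
        refine prod_congr rfl fun i _ => ?_
        rw [card_powersetCard]
        congr 1
        exact hU i.castSucc
      rw [hdouble, ← hcard, mul_comm, ← smul_eq_mul]
      refine sum_le_card_nsmul _ _ _ fun S hS => ?_
      by_contra! hlt
      obtain ⟨T, hTsub, hTcard⟩ := exists_subset_card_eq (Nat.le_of_pred_lt hlt)
      have hmem : (Fin.snoc S T : Fin (k + 1) → Finset α) ∈ transversalCopies r U E := by
        rw [mem_transversalCopies]
        constructor
        · intro i
          induction i using Fin.lastCases with
          | last =>
            rw [Fin.snoc_last]
            exact ⟨hTsub.trans (filter_subset _ _), hTcard⟩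
          | cast i =>
            rw [Fin.snoc_castSucc]
            exact mem_powersetCard.1 (Fintype.mem_piFinset.1 hS i)
        · intro g hg
          rw [Fintype.mem_piFinset] at hg
          have hlast := hg (Fin.last k)
          rw [Fin.snoc_last] at hlast
          have hmemInit : Fin.init g ∈ Fintype.piFinset S := by
            rw [Fintype.mem_piFinset]
            intro i
            have hi := hg i.castSucc
            rwa [Fin.snoc_castSucc] at hi
          have hgL := (mem_filter.1 ((mem_filter.1 (hTsub hlast)).2 hmemInit)).2
          rwa [Fin.snoc_init_self] at hgL
      simp [h] at hmem
    calc E.card ≤ ∑ v ∈ W, (L v).card := hfib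
      _ ≤ ∑ v ∈ W, (partiteTuranBound N r k + (transversalCopies r V (L v)).card) :=
        sum_le_sum hlink
      _ = N k * partiteTuranBound N r k + ∑ v ∈ W, (transversalCopies r V (L v)).card := by
        rw [sum_add_distrib, sum_const, smul_eq_mul, hW, hU, Fin.val_last]
      _ ≤ _ := Nat.add_le_add_left hcount _

theorem pred_mul_prod_choose_le (n r k : ℕ) :
    (r - 1) * ∏ i ∈ Finset.range (k + 1), (n ^ r ^ i).choose r ≤
      n ^ (r * ∑ i ∈ Finset.range (k + 1), r ^ i) := by
  have hfirst : (r - 1) * n.choose r ≤ n ^ r := by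
    calc (r - 1) * n.choose r ≤ r.factorial * n.choose r :=
          Nat.mul_le_mul_right _ ((Nat.sub_le r 1).trans r.self_le_factorial)
      _ = n.descFactorial r := (Nat.descFactorial_eq_factorial_mul_choose n r).symm
      _ ≤ n ^ r := Nat.descFactorial_le_pow n r
  have hrest : ∏ i ∈ Finset.range k, (n ^ r ^ (i + 1)).choose r ≤
      ∏ i ∈ Finset.range k, (n ^ r ^ (i + 1)) ^ r :=
    Finset.prod_le_prod' fun i _ => Nat.choose_le_pow _ _
  rw [mul_comm r, pow_mul, ← Finset.prod_pow_eq_pow_sum, ← Finset.prod_pow,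
    Finset.prod_range_succ', Finset.prod_range_succ', mul_left_comm, mul_comm (Finset.prod _ _),
    mul_comm (Finset.prod _ _)]
  simpa [mul_comm] using Nat.mul_le_mul hrest hfirst

theorem partiteTuranBound_pow_le (n r k : ℕ) (hr : 0 < r) :
    partiteTuranBound (fun i => n ^ r ^ i) r (k + 1) ≤
      (r + k - 1) * n ^ (r * ∑ i ∈ Finset.range k, r ^ i) := by
  induction k with
  | zero => simp [partiteTuranBound]
  | succ k ih =>
    rw [partiteTuranBound]
    calc _ ≤ n ^ r ^ (k + 1) * ((r + k - 1) * n ^ (r * ∑ i ∈ Finset.range k, r ^ i)) +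
          n ^ (r * ∑ i ∈ Finset.range (k + 1), r ^ i) :=
        Nat.add_le_add (Nat.mul_le_mul_left _ ih) (pred_mul_prod_choose_le n r k)
      _ = (r + k - 1 + 1) * n ^ (r * ∑ i ∈ Finset.range (k + 1), r ^ i) := by
        rw [Finset.sum_range_succ, mul_add, pow_add, ← pow_succ']
        ring
      _ = _ := by congr 1; omega

/-- **Tightness for `K^{(k)}_{r,…,r}`-free subhypergraphs.** Let `k, r ≥ 2`,
`q = (r^k − 1)/(r − 1)` and `n ≥ r`. Let `G` be the complete `k`-partite `k`-graph with
parts `U 0, …, U (k-1)` of sizes `|U i| = n^{r^i}` (so `G` has `m = n^q` edges). Then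
every subhypergraph of `G` with no copy of `K^{(k)}_{r,…,r}` has at most
`(r + k − 2) · n^{q−1} = (r + k − 2) · m^{(q−1)/q}` edges. -/
theorem stmt7 {α : Type*} [DecidableEq α] (k r q n : ℕ) (hk : 2 ≤ k) (hr : 2 ≤ r)
    (hq : q = (r ^ k - 1) / (r - 1)) (hn : r ≤ n)
    (U : Fin k → Finset α) (hUdisj : ∀ i j, i ≠ j → Disjoint (U i) (U j))
    (hUcard : ∀ i, (U i).card = n ^ r ^ (i : ℕ))
    (G' : Finset (Finset α))
    (hsub : ∀ e ∈ G', ∃ g : Fin k → α, (∀ i, g i ∈ U i) ∧ e = Finset.image g Finset.univ)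
    (hfree : ¬ HasKrrrCopy G' k r) :
    G'.card ≤ (r + k - 2) * n ^ (q - 1) := by
  obtain ⟨k, rfl⟩ : ∃ l, k = l + 1 := ⟨k - 1, by omega⟩
  have hexp : q - 1 = r * ∑ i ∈ Finset.range k, r ^ i := by
    rw [hq, ← Nat.geomSum_eq hr, Finset.sum_range_succ', Finset.mul_sum, pow_zero,
      Nat.add_sub_cancel]
    exact Finset.sum_congr rfl fun i _ => pow_succ' r i
  set E : Finset (Fin (k + 1) → α) :=
    {g ∈ Fintype.piFinset U | Finset.image g Finset.univ ∈ G'} with hE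
  have hGE : G'.card ≤ E.card := by
    refine (Finset.card_le_card fun e he => ?_).trans
      (Finset.card_image_le (s := E) (f := fun g => Finset.image g Finset.univ))
    obtain ⟨g, hg, rfl⟩ := hsub e he
    exact Finset.mem_image_of_mem _ (Finset.mem_filter.2 ⟨Fintype.mem_piFinset.2 hg, he⟩)
  have hnone : transversalCopies r U E = ∅ := by
    by_contra hne
    obtain ⟨S, hS⟩ := Finset.nonempty_iff_ne_empty.2 hne
    rw [mem_transversalCopies] at hS
    exact hfree ⟨S, fun i => (hS.1 i).2,
      fun i j hij => Finset.disjoint_of_subset_left (hS.1 i).1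
        (Finset.disjoint_of_subset_right (hS.1 j).1 (hUdisj i j hij)),
      fun g hg => (Finset.mem_filter.1 (hS.2 (Fintype.mem_piFinset.2 hg))).2⟩
  have hbound := card_le_partiteTuranBound_add (by omega : 0 < r) (fun i => n ^ r ^ i) (k + 1) U
    hUcard E (Finset.filter_subset _ _)
  rw [hnone, Finset.card_empty, add_zero] at hbound
  rw [hexp, show r + (k + 1) - 2 = r + k - 1 by omega]
  exact hGE.trans (hbound.trans (partiteTuranBound_pow_le n r k (by omega)))
end

section
/- Let k ≥ 2, r ≥ 1 and n ≥ 1 be integers. Let G be a k-partite k-graph with parts U₁, ..., U_k where |U_i| = n^{r^{i−1}}, and suppose G has exactly a·∏_{i=2}^{k} |U_i| edges, where a ≥ 0 is a real number. Then the number of copies of K^{(k)}_{r,...,r} in G is at least C(a − k + 1, r)·∏_{i=1}^{k−1} C(|U_i|, r), where for a real number t the extended binomial coefficient C(t, r) is defined as t(t−1)···(t−r+1)/r! if t ≥ r − 1 and 0 otherwise. -/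
/-- The extended binomial coefficient `C(t, r) = t(t−1)⋯(t−r+1)/r!` if `t ≥ r − 1` and
`0` otherwise, a convex function of the real variable `t`. -/
noncomputable def ebinom (t : ℝ) (r : ℕ) : ℝ :=
  if (r : ℝ) - 1 ≤ t then (∏ i ∈ Finset.range r, (t - i)) / (Nat.factorial r : ℝ) else 0

lemma ebinom_eq_prod_max {r : ℕ} (hr : 1 ≤ r) (t : ℝ) :
    ebinom t r = (∏ i ∈ Finset.range r, max (t - i) 0) / (Nat.factorial r : ℝ) := by
  unfold ebinom
  split_ifs with h
  · congr 1
    refine Finset.prod_congr rfl fun i hi => (max_eq_left ?_).symm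
    have : (i : ℝ) + 1 ≤ r := by exact_mod_cast Finset.mem_range.mp hi
    linarith
  · rw [Finset.prod_eq_zero (Finset.mem_range.mpr (Nat.sub_lt hr one_pos)), zero_div]
    rw [Nat.cast_sub hr, Nat.cast_one]
    exact max_eq_right (by linarith)

lemma prod_max_nonneg (r : ℕ) (t : ℝ) : 0 ≤ ∏ i ∈ Finset.range r, max (t - i) 0 :=
  Finset.prod_nonneg fun _ _ => le_max_right _ _

lemma monotone_prod_max (r : ℕ) :
    Monotone fun t : ℝ => ∏ i ∈ Finset.range r, max (t - i) 0 := fun s t h => by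
  refine Finset.prod_le_prod (fun _ _ => le_max_right _ _) fun i _ => ?_
  exact max_le_max (by linarith) le_rfl

lemma convexOn_prod_max (r : ℕ) :
    ConvexOn ℝ Set.univ fun t : ℝ => ∏ i ∈ Finset.range r, max (t - i) 0 := by
  induction r with
  | zero => simpa using convexOn_const (1 : ℝ) convex_univ
  | succ r ih =>
    simp only [Finset.prod_range_succ]
    have hmax : ConvexOn ℝ Set.univ fun t : ℝ => max (t - r) 0 :=
      ((convexOn_id convex_univ).sub (concaveOn_const (r : ℝ) convex_univ)).sup
        (convexOn_const (0 : ℝ) convex_univ)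
    refine ih.mul hmax (fun t _ => prod_max_nonneg r t) (fun t _ => le_max_right _ _) ?_
    have hmono : Monotone fun t : ℝ => max (t - r) 0 :=
      fun s t h => max_le_max (by linarith) le_rfl
    exact ((monotone_prod_max r).monovary hmono).monovaryOn _

lemma prod_max_natCast (m r : ℕ) :
    ∏ i ∈ Finset.range r, max ((m : ℝ) - i) 0 = (m.descFactorial r : ℝ) := by
  induction r with
  | zero => simp
  | succ r ih =>
    rw [Finset.prod_range_succ, ih, Nat.descFactorial_succ, Nat.cast_mul, mul_comm]
    congr 1
    rcases le_total r m with h | h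
    · rw [Nat.cast_sub h]
      exact max_eq_left (sub_nonneg.mpr (by exact_mod_cast h))
    · rw [Nat.sub_eq_zero_of_le h, Nat.cast_zero]
      exact max_eq_right (sub_nonpos.mpr (by exact_mod_cast h))

lemma ebinom_natCast {r : ℕ} (hr : 1 ≤ r) (m : ℕ) : ebinom (m : ℝ) r = (m.choose r : ℝ) := by
  rw [ebinom_eq_prod_max hr, prod_max_natCast, Nat.descFactorial_eq_factorial_mul_choose,
    Nat.cast_mul, mul_div_cancel_left₀ _ (by positivity)]

lemma monotone_ebinom {r : ℕ} (hr : 1 ≤ r) : Monotone fun t => ebinom t r := fun s t h => by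
  simp only [ebinom_eq_prod_max hr]
  exact div_le_div_of_nonneg_right (monotone_prod_max r h) (by positivity)

lemma ebinom_nonneg {r : ℕ} (hr : 1 ≤ r) (t : ℝ) : 0 ≤ ebinom t r := by
  rw [ebinom_eq_prod_max hr]
  exact div_nonneg (prod_max_nonneg r t) (by positivity)

lemma convexOn_ebinom {r : ℕ} (hr : 1 ≤ r) : ConvexOn ℝ Set.univ fun t => ebinom t r := by
  have h := (convexOn_prod_max r).smul (c := ((Nat.factorial r : ℝ))⁻¹) (by positivity)
  refine h.congr fun t _ => ?_
  simp only [ebinom_eq_prod_max hr, smul_eq_mul]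
  ring

lemma ebinom_eq_zero_of_lt {r : ℕ} {t : ℝ} (h : t < r - 1) : ebinom t r = 0 := by
  rw [ebinom, if_neg (not_le.mpr h)]

lemma le_factorial_mul_ebinom {r : ℕ} (hr : 1 ≤ r) {t : ℝ} (ht : r ≤ t) :
    t ≤ Nat.factorial r * ebinom t r := by
  rw [ebinom, if_pos (by linarith), mul_div_cancel₀ _ (by positivity)]
  obtain ⟨s, rfl⟩ : ∃ s, r = s + 1 := ⟨r - 1, by omega⟩
  push_cast at ht
  rw [Finset.prod_range_succ', Nat.cast_zero, sub_zero]
  have hs : (0 : ℝ) ≤ s := s.cast_nonneg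
  refine le_mul_of_one_le_left (by linarith) ?_
  rw [← Finset.prod_const_one (s := Finset.range s)]
  refine Finset.prod_le_prod (fun _ _ => zero_le_one) fun i hi => ?_
  have : (i : ℝ) + 1 ≤ s := by exact_mod_cast Finset.mem_range.mp hi
  push_cast
  linarith

/-- Jensen's inequality for the uniform weight on a finite set. -/
lemma card_mul_ebinom_le_sum {ι : Type*} {r : ℕ} (hr : 1 ≤ r) (s : Finset ι) (x : ι → ℝ)
    {t : ℝ} (ht : s.card * t ≤ ∑ i ∈ s, x i) :
    s.card * ebinom t r ≤ ∑ i ∈ s, ebinom (x i) r := by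
  rcases s.eq_empty_or_nonempty with rfl | hs
  · simp
  have hpos : (0 : ℝ) < s.card := by exact_mod_cast hs.card_pos
  have h := (convexOn_ebinom hr).map_sum_le (t := s) (w := fun _ => (s.card : ℝ)⁻¹) (p := x)
    (fun _ _ => by positivity) (by simp [hpos.ne']) (fun _ _ => Set.mem_univ _)
  simp only [smul_eq_mul, ← Finset.mul_sum] at h
  have hle : t ≤ (s.card : ℝ)⁻¹ * ∑ i ∈ s, x i := by
    rw [inv_mul_eq_div, le_div_iff₀ hpos]
    linarith
  have h' := (monotone_ebinom hr hle).trans h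
  rw [inv_mul_eq_div, le_div_iff₀ hpos] at h'
  linarith

section

variable {α : Type*} [DecidableEq α]

/-- The copies of `K_{r,…,r}` with parts inside `U` in a set `E` of transversals. -/
def blowupCopies {k : ℕ} (r : ℕ) (U : Fin k → Finset α) (E : Finset (Fin k → α)) :
    Finset (Fin k → Finset α) :=
  (Fintype.piFinset fun i => (U i).powersetCard r).filter fun S => Fintype.piFinset S ⊆ E

/-- The link of the vertex `v` of the last part. -/
def lastLink {k : ℕ} (U : Fin (k + 1) → Finset α) (E : Finset (Fin (k + 1) → α)) (v : α) :
    Finset (Fin k → α) :=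
  (Fintype.piFinset (Fin.init U)).filter fun g => (Fin.snoc g v : Fin (k + 1) → α) ∈ E

lemma card_le_sum_card_lastLink {k : ℕ} (U : Fin (k + 1) → Finset α)
    (E : Finset (Fin (k + 1) → α)) (hE : E ⊆ Fintype.piFinset U) :
    E.card ≤ ∑ v ∈ U (Fin.last k), (lastLink U E v).card := by
  rw [← Finset.card_sigma]
  refine Finset.card_le_card_of_injOn (fun g => ⟨g (Fin.last k), Fin.init g⟩) ?_ ?_
  · intro g hg
    have hU := Fintype.mem_piFinset.mp (hE hg)
    simp only [Finset.coe_sigma, Set.mem_sigma_iff, Finset.mem_coe, lastLink, Finset.mem_filter,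
      Fintype.mem_piFinset, Fin.snoc_init_self]
    exact ⟨hU _, fun i => hU _, hg⟩
  · intro g _ h _ hgh
    obtain ⟨h1, h2⟩ := Sigma.mk.inj_iff.mp hgh
    rw [← Fin.snoc_init_self g, ← Fin.snoc_init_self h, h1, eq_of_heq h2]

lemma sum_choose_le_card_blowupCopies {k r : ℕ} (U : Fin (k + 1) → Finset α)
    (E : Finset (Fin (k + 1) → α)) :
    ∑ S ∈ Fintype.piFinset fun i => (Fin.init U i).powersetCard r,
      ((U (Fin.last k)).filter fun v => Fintype.piFinset S ⊆ lastLink U E v).card.choose r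
      ≤ (blowupCopies r U E).card := by
  simp only [← Finset.card_powersetCard]
  rw [← Finset.card_sigma]
  refine Finset.card_le_card_of_injOn
    (fun p => (Fin.snoc p.1 p.2 : Fin (k + 1) → Finset α)) ?_ ?_
  · rintro ⟨S, W⟩ hp
    simp only [Finset.coe_sigma, Set.mem_sigma_iff, Finset.mem_coe, Fintype.mem_piFinset,
      Finset.mem_powersetCard] at hp
    obtain ⟨hS, hW, hWr⟩ := hp
    simp only [blowupCopies, Finset.coe_filter, Set.mem_ofPred_eq, Fintype.mem_piFinset,
      Finset.mem_powersetCard]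
    refine ⟨fun i => ?_, fun g hg => ?_⟩
    · refine Fin.lastCases ?_ (fun j => ?_) i
      · simpa using ⟨hW.trans (Finset.filter_subset _ _), hWr⟩
      · simpa [Fin.init] using hS j
    · rw [Fintype.mem_piFinset] at hg
      have hlast := hg (Fin.last k)
      rw [Fin.snoc_last] at hlast
      have hlink := (Finset.mem_filter.mp (hW hlast)).2
      have hinit : Fin.init g ∈ Fintype.piFinset S := Fintype.mem_piFinset.mpr fun i => by
        simpa [Fin.init] using hg i.castSucc
      simpa using (Finset.mem_filter.mp (hlink hinit)).2
  · rintro ⟨S, W⟩ _ ⟨S', W'⟩ _ h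
    obtain ⟨rfl, rfl⟩ := Fin.snoc_injective2 h
    rfl

lemma sum_card_blowupCopies_lastLink {k r : ℕ} (U : Fin (k + 1) → Finset α)
    (E : Finset (Fin (k + 1) → α)) :
    ∑ v ∈ U (Fin.last k), (blowupCopies r (Fin.init U) (lastLink U E v)).card =
    ∑ S ∈ Fintype.piFinset fun i => (Fin.init U i).powersetCard r,
      ((U (Fin.last k)).filter fun v => Fintype.piFinset S ⊆ lastLink U E v).card :=
  Finset.sum_card_bipartiteAbove_eq_sum_card_bipartiteBelow
    (fun v S => Fintype.piFinset S ⊆ lastLink U E v)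

lemma choose_card_le_card_blowupCopies_one {r : ℕ} (U : Fin 1 → Finset α)
    (E : Finset (Fin 1 → α)) (hE : E ⊆ Fintype.piFinset U) :
    E.card.choose r ≤ (blowupCopies r U E).card := by
  have hinj : Function.Injective fun g : Fin 1 → α => g 0 := fun g h hgh =>
    funext fun i => by rw [Subsingleton.elim i 0]; exact hgh
  rw [← Finset.card_image_of_injective E hinj, ← Finset.card_powersetCard]
  refine Finset.card_le_card_of_injOn (fun W _ => W) ?_ fun W _ W' _ h => congrFun h 0
  intro W hW
  obtain ⟨hW, hWr⟩ := Finset.mem_powersetCard.mp hW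
  simp only [blowupCopies, Finset.coe_filter, Set.mem_ofPred_eq, Fintype.mem_piFinset,
    Finset.mem_powersetCard]
  refine ⟨fun i => ⟨fun v hv => ?_, hWr⟩, fun g hg => ?_⟩
  · obtain ⟨g, hg, rfl⟩ := Finset.mem_image.mp (hW hv)
    rw [Subsingleton.elim i 0]
    exact Fintype.mem_piFinset.mp (hE hg) 0
  · obtain ⟨h, hh, hgh⟩ := Finset.mem_image.mp (hW (Fintype.mem_piFinset.mp hg 0))
    rwa [← hinj hgh]

lemma ebinom_mul_prod_le_card_blowupCopies {r n : ℕ} (hr : 1 ≤ r) (hn : 1 ≤ n) (m : ℕ) (a : ℝ)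
    (U : Fin (m + 1) → Finset α) (hU : ∀ i, (U i).card = n ^ r ^ (i : ℕ))
    (E : Finset (Fin (m + 1) → α)) (hE : E ⊆ Fintype.piFinset U)
    (ha : (E.card : ℝ) = a * ∏ i : Fin m, ((U i.succ).card : ℝ)) :
    ebinom (a - m) r * ∏ i : Fin m, ((U i.castSucc).card.choose r : ℝ)
      ≤ (blowupCopies r U E).card := by
  induction m generalizing a with
  | zero =>
    simp only [Finset.univ_eq_empty, Finset.prod_empty, mul_one] at ha ⊢
    rw [← ha, Nat.cast_zero, sub_zero, ebinom_natCast hr]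
    exact_mod_cast choose_card_le_card_blowupCopies_one U E hE
  | succ m ih =>
    set T := Fintype.piFinset fun i => (Fin.init U i).powersetCard r with hT
    set D : (Fin (m + 1) → Finset α) → Finset α := fun S =>
      (U (Fin.last (m + 1))).filter fun v => Fintype.piFinset S ⊆ lastLink U E v with hD
    set N := (U (Fin.last m).castSucc).card with hN
    set M := (U (Fin.last (m + 1))).card with hM
    set P : ℝ := ∏ i : Fin m, ((Fin.init U i.castSucc).card.choose r : ℝ) with hP
    set Q : ℝ := ∏ i : Fin m, ((Fin.init U i.succ).card : ℝ) with hQ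
    have hTcard : (T.card : ℝ) = P * N.choose r := by
      rw [hT, Fintype.card_piFinset, Fin.prod_univ_castSucc]
      simp [hP, hN, Fin.init]
    have hprod : ∏ i : Fin (m + 1), ((U i.castSucc).card.choose r : ℝ) = T.card := by
      rw [hTcard, Fin.prod_univ_castSucc]
      rfl
    have hE' : (E.card : ℝ) = a * Q * M := by
      rw [ha, Fin.prod_univ_castSucc, mul_assoc]
      rfl
    have hQpos : 0 < Q := Finset.prod_pos fun i _ => by
      simp only [Fin.init, hU]
      positivity
    have hP0 : 0 ≤ P := Finset.prod_nonneg fun i _ => Nat.cast_nonneg _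
    have hMN : M = N ^ r := by
      rw [hM, hN, hU, hU, ← pow_mul, ← pow_succ]
      rfl
    rw [hprod]
    rcases lt_or_ge (a - (m + 1 : ℕ)) (r - 1) with hlt | hge
    · rw [ebinom_eq_zero_of_lt hlt, zero_mul]
      positivity
    push_cast at hge ⊢
    have hlink : ∀ v ∈ U (Fin.last (m + 1)),
        ebinom ((lastLink U E v).card / Q - m) r * P
          ≤ (blowupCopies r (Fin.init U) (lastLink U E v)).card := fun v _ =>
      ih _ (Fin.init U) (fun i => hU _) _ (Finset.filter_subset _ _)
        (div_mul_cancel₀ _ hQpos.ne').symm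
    have hjensen : M * ebinom (a - m) r ≤
        ∑ v ∈ U (Fin.last (m + 1)), ebinom ((lastLink U E v).card / Q - m) r := by
      refine card_mul_ebinom_le_sum hr _ _ ?_
      have hsum : (E.card : ℝ) ≤ ∑ v ∈ U (Fin.last (m + 1)), ((lastLink U E v).card : ℝ) := by
        exact_mod_cast card_le_sum_card_lastLink U E hE
      rw [Finset.sum_sub_distrib, ← Finset.sum_div, Finset.sum_const, nsmul_eq_mul, ← hM, mul_sub]
      refine sub_le_sub_right ?_ _
      rw [le_div_iff₀ hQpos]
      linarith
    have hdeg : M * ebinom (a - m) r * P ≤ ∑ S ∈ T, ((D S).card : ℝ) := by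
      have h := Finset.sum_le_sum hlink
      rw [← Finset.sum_mul] at h
      have heq : ∑ v ∈ U (Fin.last (m + 1)),
          ((blowupCopies r (Fin.init U) (lastLink U E v)).card : ℝ)
            = ∑ S ∈ T, ((D S).card : ℝ) := by
        exact_mod_cast sum_card_blowupCopies_lastLink (r := r) U E
      rw [← heq]
      exact (mul_le_mul_of_nonneg_right hjensen hP0).trans h
    have hchoose : (N.choose r : ℝ) * Nat.factorial r ≤ M := by
      rw [hMN, mul_comm]
      exact_mod_cast (Nat.descFactorial_eq_factorial_mul_choose N r) ▸ Nat.descFactorial_le_pow N r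
    have hfac := le_factorial_mul_ebinom hr (t := a - m) (by linarith)
    have havg : T.card * (a - (m + 1)) ≤ ∑ S ∈ T, ((D S).card : ℝ) := by
      refine le_trans ?_ hdeg
      calc (T.card : ℝ) * (a - (m + 1)) ≤ T.card * (Nat.factorial r * ebinom (a - m) r) :=
            mul_le_mul_of_nonneg_left (by linarith) (Nat.cast_nonneg _)
        _ = N.choose r * Nat.factorial r * (ebinom (a - m) r * P) := by rw [hTcard]; ring
        _ ≤ M * (ebinom (a - m) r * P) :=
            mul_le_mul_of_nonneg_right hchoose (mul_nonneg (ebinom_nonneg hr _) hP0)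
        _ = M * ebinom (a - m) r * P := by ring
    have hfinal := card_mul_ebinom_le_sum hr T _ havg
    simp only [ebinom_natCast hr] at hfinal
    rw [mul_comm]
    refine hfinal.trans ?_
    exact_mod_cast sum_choose_le_card_blowupCopies U E

lemma injOn_image_univ_piFinset {k : ℕ} {U : Fin k → Finset α}
    (hU : ∀ i j, i ≠ j → Disjoint (U i) (U j)) :
    Set.InjOn (fun g : Fin k → α => Finset.image g Finset.univ) (Fintype.piFinset U) := by
  intro g hg h hh hgh
  rw [Finset.mem_coe, Fintype.mem_piFinset] at hg hh
  funext i
  have hmem : g i ∈ Finset.image h Finset.univ :=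
    (show Finset.image g Finset.univ = Finset.image h Finset.univ from hgh) ▸
      Finset.mem_image_of_mem g (Finset.mem_univ i)
  obtain ⟨j, -, hj⟩ := Finset.mem_image.mp hmem
  rcases eq_or_ne j i with rfl | hne
  · exact hj.symm
  · exact absurd (hg i) (Finset.disjoint_left.mp (hU j i hne) (hj ▸ hh j))

end

/-- **Counting copies of `K^{(k)}_{r,…,r}` in dense `k`-partite `k`-graphs.**
Let `k ≥ 2`, `r ≥ 1`, `n ≥ 1`. Let `G` be a `k`-partite `k`-graph with parts
`U 0, …, U (k-1)` of sizes `|U i| = n^{r^i}`, with exactly `a · ∏_{i ≥ 1} |U i|` edges,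
`a ≥ 0` real. Then the number of copies of `K^{(k)}_{r,…,r}` in `G` (tuples
`S 0 ⊆ U 0, …, S (k-1) ⊆ U (k-1)` of `r`-sets with all transversals being edges) is at
least `C(a − k + 1, r) · ∏_{i < k-1} C(|U i|, r)`. -/
theorem stmt8 {α : Type*} [DecidableEq α] (k r n : ℕ) (hk : 2 ≤ k) (hr : 1 ≤ r)
    (hn : 1 ≤ n) (a : ℝ) (ha : 0 ≤ a)
    (U : Fin k → Finset α) (hUdisj : ∀ i j, i ≠ j → Disjoint (U i) (U j))
    (hUcard : ∀ i, (U i).card = n ^ r ^ (i : ℕ))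
    (G : Finset (Finset α))
    (hpartite : ∀ e ∈ G, ∃ g : Fin k → α, (∀ i, g i ∈ U i) ∧ e = Finset.image g Finset.univ)
    (hm : (G.card : ℝ) = a * ∏ i ∈ Finset.univ.filter (fun i : Fin k => 1 ≤ (i : ℕ)),
      ((U i).card : ℝ)) :
    ebinom (a - k + 1) r * ∏ i ∈ Finset.univ.filter (fun i : Fin k => (i : ℕ) < k - 1),
        ebinom ((U i).card : ℝ) r
      ≤ ({S : Fin k → Finset α | (∀ i, S i ⊆ U i) ∧ (∀ i, (S i).card = r) ∧
          ∀ g : Fin k → α, (∀ i, g i ∈ S i) → Finset.image g Finset.univ ∈ G}.ncard : ℝ) := by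
  obtain ⟨m, rfl⟩ : ∃ m, k = m + 1 := ⟨k - 1, by omega⟩
  set E := (Fintype.piFinset U).filter fun g => Finset.image g Finset.univ ∈ G with hE
  have hEcard : E.card = G.card := by
    rw [← Finset.card_image_of_injOn
      ((injOn_image_univ_piFinset hUdisj).mono (Finset.filter_subset _ _))]
    congr 1
    ext e
    simp only [Finset.mem_image, Finset.mem_filter, Fintype.mem_piFinset]
    constructor
    · rintro ⟨g, ⟨-, hg⟩, rfl⟩
      exact hg
    · intro he
      obtain ⟨g, hg, rfl⟩ := hpartite e he
      exact ⟨g, ⟨hg, he⟩, rfl⟩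
  have hcopies : {S : Fin (m + 1) → Finset α | (∀ i, S i ⊆ U i) ∧ (∀ i, (S i).card = r) ∧
      ∀ g : Fin (m + 1) → α, (∀ i, g i ∈ S i) → Finset.image g Finset.univ ∈ G}
      = (blowupCopies r U E : Set (Fin (m + 1) → Finset α)) := by
    ext S
    simp only [blowupCopies, hE, Set.mem_ofPred_eq, Finset.coe_filter, Fintype.mem_piFinset,
      Finset.mem_powersetCard, Finset.subset_iff, Finset.mem_filter]
    constructor
    · rintro ⟨h1, h2, h3⟩
      exact ⟨fun i => ⟨h1 i, h2 i⟩, fun g hg => ⟨fun i => h1 i (hg i), h3 g hg⟩⟩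
    · rintro ⟨h1, h2⟩
      exact ⟨fun i => (h1 i).1, fun i => (h1 i).2, fun g hg => (h2 hg).2⟩
  have htail : ∏ i ∈ Finset.univ.filter (fun i : Fin (m + 1) => 1 ≤ (i : ℕ)), ((U i).card : ℝ)
      = ∏ i : Fin m, ((U i.succ).card : ℝ) := by
    rw [Finset.prod_filter, Fin.prod_univ_succ]
    simp
  have hinit : ∏ i ∈ Finset.univ.filter (fun i : Fin (m + 1) => (i : ℕ) < m + 1 - 1),
      ebinom ((U i).card : ℝ) r = ∏ i : Fin m, ((U i.castSucc).card.choose r : ℝ) := by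
    rw [Finset.prod_filter, Fin.prod_univ_castSucc]
    simp [ebinom_natCast hr]
  rw [hcopies, Set.ncard_coe_finset, hinit]
  convert ebinom_mul_prod_le_card_blowupCopies hr hn m a U hUcard E (Finset.filter_subset _ _)
    (by rw [hEcard, hm, htail]) using 3
  push_cast
  ring
end

section
/- Let k ≥ 1 and Δ ≥ 1 be integers. Let H be a hypergraph on n vertices in which every edge has size at most k and every vertex lies in at most Δ edges. Let N ≥ 16n and let δ be a real number with δ ≤ (1/(4kΔ))·2^{−8kn/N}. If G is a down-closed hypergraph on a vertex set of size N having more than (1 − δ)·C(N, k) edges of size k, then there is a copy of H in G, i.e., an injective map φ from the vertices of H to the vertices of G such that φ(e) is an edge of G for every edge e of H. -/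
section Embedding

open Finset

variable {V W : Type*} [Fintype V] [Fintype W] [DecidableEq V] [DecidableEq W]

open scoped Classical in
/-- The maps `V → W` whose restriction to `S` is injective and sends every edge of `H` inside `S`
to an edge of `G`. -/
noncomputable def goodMaps (H : Finset (Finset V)) (G : Finset (Finset W)) (S : Finset V) :
    Finset (V → W) :=
  {φ | Set.InjOn φ S ∧ ∀ e ∈ H, e ⊆ S → e.image φ ∈ G}

open scoped Classical in
/-- The maps `V → W` which are injective on `e` but send `e` to a non-edge of `G`. -/
noncomputable def badMaps (G : Finset (Finset W)) (e : Finset V) : Finset (V → W) :=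
  {φ | Set.InjOn φ e ∧ e.image φ ∉ G}

/-- The permutations of `W` sending `E` to a non-edge of `G`. -/
def badPerms (G : Finset (Finset W)) (E : Finset W) : Finset (Equiv.Perm W) :=
  {σ | E.image σ ∉ G}

lemma mem_goodMaps {H : Finset (Finset V)} {G : Finset (Finset W)} {S : Finset V} {φ : V → W} :
    φ ∈ goodMaps H G S ↔ Set.InjOn φ S ∧ ∀ e ∈ H, e ⊆ S → e.image φ ∈ G := by
  simp [goodMaps]

lemma mem_badMaps {G : Finset (Finset W)} {e : Finset V} {φ : V → W} :
    φ ∈ badMaps G e ↔ Set.InjOn φ e ∧ e.image φ ∉ G := by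
  simp [badMaps]

lemma mem_badPerms {G : Finset (Finset W)} {E : Finset W} {σ : Equiv.Perm W} :
    σ ∈ badPerms G E ↔ E.image σ ∉ G := by
  simp [badPerms]

lemma goodMaps_anti (H : Finset (Finset V)) (G : Finset (Finset W)) {S T : Finset V}
    (h : S ⊆ T) : goodMaps H G T ⊆ goodMaps H G S := by
  intro φ hφ
  rw [mem_goodMaps] at hφ ⊢
  exact ⟨hφ.1.mono (by exact_mod_cast h), fun e he heS => hφ.2 e he (heS.trans h)⟩

lemma mem_goodMaps_congr {H : Finset (Finset V)} {G : Finset (Finset W)} {S : Finset V}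
    {φ ψ : V → W} (h : ∀ x ∈ S, φ x = ψ x) (hφ : φ ∈ goodMaps H G S) : ψ ∈ goodMaps H G S := by
  rw [mem_goodMaps] at hφ ⊢
  refine ⟨hφ.1.congr fun x hx => h x hx, fun e he heS => ?_⟩
  rw [← image_congr fun x hx => h x (heS hx)]
  exact hφ.2 e he heS

lemma mem_badMaps_congr {G : Finset (Finset W)} {e : Finset V} {φ ψ : V → W}
    (h : ∀ x ∈ e, φ x = ψ x) (hφ : φ ∈ badMaps G e) : ψ ∈ badMaps G e := by
  rw [mem_badMaps] at hφ ⊢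
  exact ⟨hφ.1.congr fun x hx => h x hx, by rw [← image_congr fun x hx => h x hx]; exact hφ.2⟩

/-- Conditions on disjoint sets of coordinates are independent. -/
lemma card_goodMaps_inter_badMaps_mul_le (H : Finset (Finset V)) (G : Finset (Finset W))
    {T e : Finset V} (hTe : Disjoint T e) :
    #(goodMaps H G T ∩ badMaps G e) * Fintype.card W ^ Fintype.card V ≤
      #(goodMaps H G T) * #(badMaps G e) := by
  rw [← Fintype.card_fun (α := V), ← card_univ, ← card_product, ← card_product]
  refine card_le_card_of_injOn
    (fun p => (fun x => if x ∈ e then p.2 x else p.1 x, fun x => if x ∈ e then p.1 x else p.2 x))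
    ?_ ?_
  · rintro ⟨φ, ψ⟩ h
    simp only [coe_product, Set.mem_prod, mem_coe, mem_inter] at h ⊢
    refine ⟨mem_goodMaps_congr (fun x hx => ?_) h.1.1, mem_badMaps_congr (fun x hx => ?_) h.1.2⟩
    · simp [disjoint_left.1 hTe hx]
    · simp [hx]
  · rintro ⟨φ, ψ⟩ - ⟨φ', ψ'⟩ - h
    simp only [Prod.mk.injEq, funext_iff] at h ⊢
    grind

lemma card_goodMaps_collision_mul_le (H : Finset (Finset V)) (G : Finset (Finset W))
    {S : Finset V} {u v : V} (hu : u ∈ S) (hv : v ∉ S) :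
    #{φ ∈ goodMaps H G S | φ v = φ u} * Fintype.card W ≤ #(goodMaps H G S) := by
  rw [← card_univ, ← card_product]
  have huv : u ≠ v := by rintro rfl; exact hv hu
  refine card_le_card_of_injOn (fun p => Function.update p.1 v p.2) ?_ ?_
  · rintro ⟨φ, w⟩ h
    simp only [coe_product, Set.mem_prod, mem_coe, mem_filter] at h
    refine mem_goodMaps_congr (fun x hx => ?_) h.1.1
    have : x ≠ v := by rintro rfl; exact hv hx
    simp [this]
  · rintro ⟨φ, w⟩ h ⟨φ', w'⟩ h' heq
    simp only [coe_product, Set.mem_prod, mem_coe, mem_filter] at h h'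
    have key : ∀ x, x ≠ v → φ x = φ' x := fun x hx => by
      simpa [hx] using congrFun heq x
    refine Prod.ext (funext fun x => ?_) (by simpa using congrFun heq v)
    by_cases hx : x = v
    · subst hx
      simp only
      rw [h.1.2, h'.1.2, key u huv]
    · exact key x hx

lemma goodMaps_subset_insert (H : Finset (Finset V)) (G : Finset (Finset W)) (S : Finset V)
    (v : V) :
    goodMaps H G S ⊆ goodMaps H G (insert v S) ∪
      (S.biUnion fun u => {φ ∈ goodMaps H G S | φ v = φ u}) ∪
      ({e ∈ H | v ∈ e}.biUnion fun e =>
        if e ⊆ insert v S then goodMaps H G S ∩ badMaps G e else ∅) := by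
  intro φ hφ
  by_contra hnot
  simp only [mem_union, mem_biUnion, mem_filter, not_or, not_exists, not_and] at hnot
  obtain ⟨⟨h1, h2⟩, h3⟩ := hnot
  have hφ' := mem_goodMaps.1 hφ
  have hinj : Set.InjOn φ (insert v S : Finset V) := by
    intro x hx y hy hxy
    simp only [coe_insert, Set.mem_insert_iff, mem_coe] at hx hy
    rcases hx with rfl | hx <;> rcases hy with rfl | hy
    · rfl
    · exact absurd hxy (h2 y hy hφ)
    · exact absurd hxy.symm (h2 x hx hφ)
    · exact hφ'.1 hx hy hxy
  refine h1 (mem_goodMaps.2 ⟨hinj, fun e he heS => ?_⟩)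
  by_cases hve : v ∈ e
  · have := h3 e ⟨he, hve⟩
    rw [if_pos heS, mem_inter, mem_badMaps] at this
    by_contra hG
    exact this ⟨hφ, hinj.mono (by exact_mod_cast heS), hG⟩
  · exact hφ'.2 e he ((subset_insert_iff_of_notMem hve).1 heS)

lemma card_badPerms_mono {G : Finset (Finset W)}
    (hG : ∀ e₁ e₂ : Finset W, e₁ ⊆ e₂ → e₂ ∈ G → e₁ ∈ G) {E E' : Finset W} (h : E ⊆ E') :
    #(badPerms G E) ≤ #(badPerms G E') := by
  refine card_le_card fun σ hσ => ?_
  rw [mem_badPerms] at hσ ⊢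
  exact fun h' => hσ (hG _ _ (image_subset_image h) h')

lemma exists_perm_image_eq {E E' : Finset W} (h : #E = #E') :
    ∃ τ : Equiv.Perm W, E.image τ = E' := by
  let f : {x // x ∈ E} ≃ {x // x ∈ E'} := equivOfCardEq h
  refine ⟨f.extendSubtype, eq_of_subset_of_card_le ?_ ?_⟩
  · intro y hy
    obtain ⟨x, hx, rfl⟩ := mem_image.1 hy
    exact f.extendSubtype_mem x hx
  · rw [card_image_of_injective _ f.extendSubtype.injective, h]

lemma card_badPerms_le {G : Finset (Finset W)} {E E' : Finset W} (h : #E = #E') :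
    #(badPerms G E) ≤ #(badPerms G E') := by
  obtain ⟨τ, rfl⟩ := exists_perm_image_eq h
  refine card_le_card_of_injOn (fun σ => σ * τ⁻¹) (fun σ hσ => ?_) fun σ _ σ' _ => by simp
  rw [mem_coe, mem_badPerms] at hσ ⊢
  rw [image_image]
  convert hσ using 3
  ext x
  simp

lemma card_badPerms_mul_choose (G : Finset (Finset W)) (E : Finset W) :
    #(badPerms G E) * (Fintype.card W).choose #E =
      (Fintype.card W).factorial * #{F ∈ powersetCard #E (univ : Finset W) | F ∉ G} := by
  have h1 : ∑ F ∈ powersetCard #E (univ : Finset W), #(badPerms G F) =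
      #(badPerms G E) * (Fintype.card W).choose #E := by
    rw [sum_congr rfl fun F hF => le_antisymm
      (card_badPerms_le (mem_powersetCard.1 hF).2) (card_badPerms_le (mem_powersetCard.1 hF).2.symm)]
    simp [mul_comm]
  have h2 : ∀ σ : Equiv.Perm W, #{F ∈ powersetCard #E (univ : Finset W) | F.image σ ∉ G} =
      #{F ∈ powersetCard #E (univ : Finset W) | F ∉ G} := by
    intro σ
    refine card_nbij' (fun F => F.image σ) (fun F => F.image σ.symm) ?_ ?_ ?_ ?_
    · intro F hF
      simpa [card_image_of_injective _ σ.injective] using hF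
    · intro F hF
      simpa [card_image_of_injective _ σ.symm.injective, image_image] using hF
    · intro F _
      simp [image_image]
    · intro F _
      simp [image_image]
  rw [← h1]
  simp only [badPerms, card_filter]
  rw [sum_comm]
  simp only [← card_filter, h2]
  simp [Fintype.card_perm]

lemma card_badMaps_mul_factorial_le {G : Finset (Finset W)} {e : Finset V} {D : ℕ}
    (hD : ∀ E : Finset W, #E = #e → #(badPerms G E) ≤ D) :
    #(badMaps G e) * (Fintype.card W).factorial ≤ Fintype.card W ^ Fintype.card V * D := by
  classical
  have h1 : ∀ σ : Equiv.Perm W,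
      #(badMaps G e) = #{φ : V → W | Set.InjOn φ e ∧ (e.image φ).image σ ∉ G} := by
    intro σ
    refine card_nbij' (fun φ => σ.symm ∘ φ) (fun φ => σ ∘ φ) ?_ ?_ ?_ ?_
    · intro φ hφ
      have := mem_badMaps.1 hφ
      simp only [coe_filter, mem_univ, true_and, Set.mem_ofPred_eq]
      refine ⟨σ.symm.injective.comp_injOn this.1, ?_⟩
      rw [image_image, ← Function.comp_assoc]
      simpa using this.2
    · intro φ hφ
      simp only [coe_filter, mem_univ, true_and, Set.mem_ofPred_eq] at hφ
      rw [mem_coe, mem_badMaps]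
      exact ⟨σ.injective.comp_injOn hφ.1, by simpa [image_image] using hφ.2⟩
    · intro φ _
      simp [← Function.comp_assoc]
    · intro φ _
      simp [← Function.comp_assoc]
  calc #(badMaps G e) * (Fintype.card W).factorial
      = ∑ σ : Equiv.Perm W, #{φ : V → W | Set.InjOn φ e ∧ (e.image φ).image σ ∉ G} := by
        rw [← sum_congr rfl fun σ _ => h1 σ]
        simp [Fintype.card_perm, mul_comm]
    _ = ∑ φ : V → W, #{σ : Equiv.Perm W | Set.InjOn φ e ∧ (e.image φ).image σ ∉ G} := by
        simp only [card_filter]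
        exact sum_comm
    _ ≤ ∑ _φ : V → W, D := by
        refine sum_le_sum fun φ _ => ?_
        by_cases hφ : Set.InjOn φ e
        · refine le_trans (card_le_card fun σ hσ => ?_) (hD (e.image φ) (card_image_of_injOn hφ))
          exact mem_badPerms.2 (mem_filter.1 hσ).2.2
        · simp [hφ]
    _ = Fintype.card W ^ Fintype.card V * D := by simp

lemma card_badMaps_mul_choose_le {G : Finset (Finset W)}
    (hG : ∀ e₁ e₂ : Finset W, e₁ ⊆ e₂ → e₂ ∈ G → e₁ ∈ G) {e : Finset V} {k : ℕ}
    (he : #e ≤ k) (hk : k ≤ Fintype.card W) :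
    #(badMaps G e) * (Fintype.card W).choose k ≤
      Fintype.card W ^ Fintype.card V * #{F ∈ powersetCard k (univ : Finset W) | F ∉ G} := by
  obtain ⟨K, -, rfl⟩ := exists_subset_card_eq (s := (univ : Finset W)) (by simpa using hk)
  have hD : ∀ E : Finset W, #E = #e → #(badPerms G E) ≤ #(badPerms G K) := by
    intro E hE
    obtain ⟨E', hE', -, hcard⟩ := exists_subsuperset_card_eq (subset_univ E) (hE.trans_le he)
      (by simpa using hk)
    exact (card_badPerms_mono hG hE').trans (card_badPerms_le hcard)
  have h1 := Nat.mul_le_mul_right ((Fintype.card W).choose #K) (card_badMaps_mul_factorial_le hD)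
  rw [mul_assoc (_ ^ _), card_badPerms_mul_choose] at h1
  refine Nat.le_of_mul_le_mul_left ?_ (Nat.factorial_pos (Fintype.card W))
  linarith

lemma pow_mul_card_goodMaps_le {H : Finset (Finset V)} {G : Finset (Finset W)} {q : ℝ}
    (hq : 0 ≤ q) {S : Finset V}
    (hstep : ∀ T ⊂ S, ∀ v ∉ T, q * #(goodMaps H G T) ≤ #(goodMaps H G (insert v T)))
    (A : Finset V) (hA : A ⊆ S) :
    q ^ #A * #(goodMaps H G (S \ A)) ≤ #(goodMaps H G S) := by
  induction A using Finset.induction_on with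
  | empty => simp
  | insert a A ha ih =>
    have haS : a ∈ S := hA (mem_insert_self a A)
    have h1 := hstep (S \ insert a A)
      (ssubset_iff_of_subset sdiff_subset |>.2 ⟨a, haS, by simp⟩) a (by simp)
    have h2 : insert a (S \ insert a A) = S \ A := by
      ext x
      simp only [mem_insert, mem_sdiff]
      by_cases hx : x = a
      · subst hx; simp [haS, ha]
      · simp [hx]
    rw [h2] at h1
    rw [card_insert_of_notMem ha, pow_succ, mul_assoc]
    exact (mul_le_mul_of_nonneg_left h1 (by positivity)).trans
      (ih ((subset_insert a A).trans hA))

lemma mul_card_goodMaps_le_insert {H : Finset (Finset V)} {G : Finset (Finset W)} {k Δ : ℕ}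
    (hHsize : ∀ e ∈ H, #e ≤ k) (hHdeg : ∀ v : V, #{e ∈ H | v ∈ e} ≤ Δ)
    {q δ : ℝ} (hq : 0 < q) (hq1 : q ≤ 1) (hδ : 0 ≤ δ) (hW : 0 < Fintype.card W)
    (hbad : ∀ e ∈ H, (#(badMaps G e) : ℝ) ≤ δ * (Fintype.card W : ℝ) ^ Fintype.card V)
    (hcond : Δ * δ ≤ (1 - (Fintype.card V : ℝ) / Fintype.card W - q) * q ^ (k - 1))
    (S : Finset V) :
    ∀ v ∉ S, q * #(goodMaps H G S) ≤ #(goodMaps H G (insert v S)) := by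
  induction S using Finset.strongInduction with
  | H S ih =>
  intro v hv
  have hW' : (0 : ℝ) < Fintype.card W := by exact_mod_cast hW
  set g : ℝ := ((goodMaps H G S).card : ℝ) with hg
  have hg0 : 0 ≤ g := by positivity
  have hcoll : ∀ u ∈ S, (#{φ ∈ goodMaps H G S | φ v = φ u} : ℝ) ≤ g / Fintype.card W := by
    intro u hu
    rw [le_div_iff₀ hW', hg]
    exact_mod_cast card_goodMaps_collision_mul_le H G hu hv
  have hedge : ∀ e ∈ ({e ∈ H | v ∈ e} : Finset (Finset V)),
      (#(if e ⊆ insert v S then goodMaps H G S ∩ badMaps G e else ∅) : ℝ) ≤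
        δ * g / q ^ (k - 1) := by
    intro e he
    obtain ⟨heH, hve⟩ := mem_filter.1 he
    split_ifs with heS
    swap
    · simp only [card_empty, Nat.cast_zero]; positivity
    have hind := card_goodMaps_inter_badMaps_mul_le H G (T := S \ e) (e := e) sdiff_disjoint
    have hsub : #(goodMaps H G S ∩ badMaps G e) ≤ #(goodMaps H G (S \ e) ∩ badMaps G e) :=
      card_le_card (inter_subset_inter_right (goodMaps_anti H G sdiff_subset))
    have hWn : (0 : ℝ) < (Fintype.card W : ℝ) ^ Fintype.card V := by positivity
    have h1 : (#(goodMaps H G S ∩ badMaps G e) : ℝ) ≤ δ * #(goodMaps H G (S \ e)) := by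
      refine le_of_mul_le_mul_right ?_ hWn
      calc (#(goodMaps H G S ∩ badMaps G e) : ℝ) * (Fintype.card W : ℝ) ^ Fintype.card V
          ≤ #(goodMaps H G (S \ e)) * #(badMaps G e) := by
            exact_mod_cast (Nat.mul_le_mul_right _ hsub).trans hind
        _ ≤ #(goodMaps H G (S \ e)) * (δ * (Fintype.card W : ℝ) ^ Fintype.card V) := by
            gcongr; exact hbad e heH
        _ = _ := by ring
    have h2 := pow_mul_card_goodMaps_le hq.le ih (e.erase v) (by rwa [← subset_insert_iff])
    have h3 : S \ e.erase v = S \ e := by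
      ext x
      simp only [mem_sdiff, mem_erase]
      have : x ∈ S → x ≠ v := by rintro hx rfl; exact hv hx
      tauto
    rw [h3, card_erase_of_mem hve] at h2
    have h4 : q ^ (k - 1) ≤ q ^ (#e - 1) :=
      pow_le_pow_of_le_one hq.le hq1 (Nat.sub_le_sub_right (hHsize e heH) 1)
    rw [le_div_iff₀ (by positivity)]
    calc (#(goodMaps H G S ∩ badMaps G e) : ℝ) * q ^ (k - 1)
        ≤ δ * #(goodMaps H G (S \ e)) * q ^ (#e - 1) := by gcongr
      _ = δ * (q ^ (#e - 1) * #(goodMaps H G (S \ e))) := by ring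
      _ ≤ δ * g := by gcongr
  have hmain : g ≤ #(goodMaps H G (insert v S)) + #S * (g / Fintype.card W) +
      #{e ∈ H | v ∈ e} * (δ * g / q ^ (k - 1)) := by
    have h1 := (card_le_card (goodMaps_subset_insert H G S v)).trans
      ((card_union_le _ _).trans (add_le_add ((card_union_le _ _).trans
        (add_le_add le_rfl card_biUnion_le)) card_biUnion_le))
    have h1' := (Nat.cast_le (α := ℝ)).2 h1
    push_cast at h1'
    rw [← nsmul_eq_mul, ← nsmul_eq_mul]
    exact h1'.trans (add_le_add (add_le_add le_rfl (sum_le_card_nsmul _ _ _ hcoll))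
      (sum_le_card_nsmul _ _ _ hedge))
  have hS : (#S : ℝ) * (g / Fintype.card W) ≤ (Fintype.card V : ℝ) / Fintype.card W * g := by
    rw [div_mul_eq_mul_div, ← mul_div_assoc]
    gcongr
    exact card_le_univ S
  have hE : (#{e ∈ H | v ∈ e} : ℝ) * (δ * g / q ^ (k - 1)) ≤
      (1 - (Fintype.card V : ℝ) / Fintype.card W - q) * g := by
    calc (#{e ∈ H | v ∈ e} : ℝ) * (δ * g / q ^ (k - 1))
        ≤ Δ * (δ * g / q ^ (k - 1)) := by
          gcongr; exact hHdeg v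
      _ = Δ * δ / q ^ (k - 1) * g := by ring
      _ ≤ _ := by
          gcongr
          rwa [div_le_iff₀ (by positivity)]
  linarith

lemma two_rpow_neg_eight_mul_le {t : ℝ} (ht0 : 0 ≤ t) (ht : t ≤ 1 / 16) :
    (2 : ℝ) ^ (-(8 * t)) ≤ 1 - t := by
  rw [Real.rpow_neg (by norm_num), inv_le_comm₀ (by positivity) (by linarith)]
  have h1 : 1 + 4 * t ≤ (2 : ℝ) ^ (8 * t) := by
    rw [Real.rpow_def_of_pos (by norm_num)]
    have := Real.add_one_le_exp (Real.log 2 * (8 * t))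
    nlinarith [Real.log_two_gt_d9]
  refine le_trans ?_ h1
  rw [inv_le_iff_one_le_mul₀ (by linarith)]
  nlinarith

lemma exists_extension_rate {k Δ n N : ℕ} (hk : 1 ≤ k) (hΔ : 1 ≤ Δ) (hN : 0 < N)
    (hNn : 16 * n ≤ N) {δ : ℝ}
    (hδ : δ ≤ (1 / (4 * k * Δ : ℝ)) * (2 : ℝ) ^ (-(8 * k * n : ℝ) / (N : ℝ))) :
    ∃ q : ℝ, 0 < q ∧ q ≤ 1 ∧ Δ * δ ≤ (1 - (n : ℝ) / N - q) * q ^ (k - 1) := by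
  have hk' : (1 : ℝ) ≤ k := by exact_mod_cast hk
  have hΔ' : (1 : ℝ) ≤ Δ := by exact_mod_cast hΔ
  have hN' : (0 : ℝ) < N := by exact_mod_cast hN
  have hNn' : (16 : ℝ) * n ≤ N := by exact_mod_cast hNn
  set t : ℝ := n / N with ht
  have ht0 : 0 ≤ t := by positivity
  have ht1 : t ≤ 1 / 16 := by rw [ht, div_le_iff₀ hN']; linarith
  set P : ℝ := (2 : ℝ) ^ (-(8 * t)) with hP
  have hP0 : 0 < P := by positivity
  have hPt : P ≤ 1 - t := two_rpow_neg_eight_mul_le ht0 ht1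
  have hPk : (2 : ℝ) ^ (-(8 * k * n : ℝ) / (N : ℝ)) = P ^ k := by
    rw [hP, ← Real.rpow_natCast, ← Real.rpow_mul (by norm_num)]
    congr 1
    rw [ht]; ring
  set r : ℝ := 1 - 1 / (2 * k) with hr
  have hk2 : 1 / (2 * (k : ℝ)) ≤ 1 / 2 := by
    gcongr; linarith
  have hk3 : 0 < 1 / (2 * (k : ℝ)) := by positivity
  have hr0 : 0 < r := by linarith
  have hr1 : r ≤ 1 := by linarith
  have hrk : 1 / 2 ≤ r ^ (k - 1) := by
    have h1 := one_add_mul_le_pow (a := -(1 / (2 * (k : ℝ)))) (by linarith) k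
    have h2 : (1 : ℝ) + k * -(1 / (2 * (k : ℝ))) = 1 / 2 := by field_simp; norm_num
    rw [h2, ← sub_eq_add_neg] at h1
    exact h1.trans (pow_le_pow_of_le_one hr0.le hr1 (Nat.sub_le k 1))
  refine ⟨P * r, by positivity, by nlinarith, ?_⟩
  calc Δ * δ ≤ Δ * ((1 / (4 * k * Δ : ℝ)) * P ^ k) := by
        rw [← hPk]; gcongr
    _ = (P * (1 / (2 * k))) * (P ^ (k - 1) * (1 / 2)) := by
        rw [← Nat.sub_add_cancel hk, pow_succ, Nat.add_sub_cancel]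
        field_simp
        norm_num
    _ ≤ (1 - t - P * r) * (P ^ (k - 1) * r ^ (k - 1)) := by
        gcongr
        · rw [hr] at *; nlinarith
        · rw [hr]; linarith
    _ = _ := by rw [mul_pow]

end Embedding

/-- **Embedding sparse hypergraphs in dense down-closed hypergraphs (local lemma
version).** Let `k, Δ ≥ 1` and let `H` be a hypergraph on `n` vertices with all edges of
size at most `k` and maximum degree at most `Δ`. Let `N ≥ 16n` and
`δ ≤ (1/(4kΔ)) · 2^{−8kn/N}`. If `G` is a down-closed hypergraph on `N` vertices with
more than `(1 − δ)·C(N, k)` edges of size `k`, then there is a copy of `H` in `G`. -/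
theorem stmt9 {V W : Type*} [Fintype V] [Fintype W] [DecidableEq V] [DecidableEq W]
    (k Δ n N : ℕ) (hk : 1 ≤ k) (hΔ : 1 ≤ Δ) (hn : Fintype.card V = n)
    (hN : Fintype.card W = N) (hNn : 16 * n ≤ N) (δ : ℝ)
    (hδ : δ ≤ (1 / (4 * k * Δ : ℝ)) * (2 : ℝ) ^ (-(8 * k * n : ℝ) / (N : ℝ)))
    (H : Finset (Finset V)) (hHsize : ∀ e ∈ H, e.card ≤ k)
    (hHdeg : ∀ v : V, (H.filter (fun e => v ∈ e)).card ≤ Δ)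
    (G : Finset (Finset W)) (hGdown : ∀ e₁ e₂ : Finset W, e₁ ⊆ e₂ → e₂ ∈ G → e₁ ∈ G)
    (hGdense : ((1 - δ) * (N.choose k) : ℝ) < ((G.filter (fun e => e.card = k)).card : ℝ)) :
    ∃ φ : V → W, Function.Injective φ ∧ ∀ e ∈ H, e.image φ ∈ G := by
  subst hn hN
  have hk' : (1 : ℝ) ≤ k := by exact_mod_cast hk
  have hΔ' : (1 : ℝ) ≤ Δ := by exact_mod_cast hΔ
  have hδ1 : δ ≤ 1 := by
    refine hδ.trans (mul_le_one₀ ?_ (by positivity) ?_)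
    · rw [div_le_one (by positivity)]; nlinarith
    · refine Real.rpow_le_one_of_one_le_of_nonpos (by norm_num) ?_
      rw [neg_div, neg_nonpos]; positivity
  obtain ⟨F, hF⟩ : (G.filter fun e => e.card = k).Nonempty := by
    rw [← Finset.card_pos, ← Nat.cast_pos (α := ℝ)]
    exact lt_of_le_of_lt (mul_nonneg (by linarith) (by positivity)) hGdense
  obtain ⟨hFG, hFk⟩ := Finset.mem_filter.1 hF
  have hempty : ∅ ∈ G := hGdown _ _ (Finset.empty_subset F) hFG
  have hkN : k ≤ Fintype.card W := hFk ▸ Finset.card_le_univ F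
  have hW : 0 < Fintype.card W := by omega
  have hchoose : (0 : ℝ) < (Fintype.card W).choose k := by
    exact_mod_cast Nat.choose_pos hkN
  have hmissing : (((Finset.powersetCard k (Finset.univ : Finset W)).filter
      fun E => E ∉ G).card : ℝ) ≤ δ * (Fintype.card W).choose k := by
    have h1 := Finset.card_filter_add_card_filter_not
      (s := Finset.powersetCard k (Finset.univ : Finset W)) (fun E => E ∈ G)
    have h2 : (Finset.powersetCard k (Finset.univ : Finset W)).filter (fun E => E ∈ G) =
        G.filter fun e => e.card = k := by
      ext E; simp [and_comm]
    rw [h2, Finset.card_powersetCard, Finset.card_univ] at h1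
    have h1' := congrArg (Nat.cast (R := ℝ)) h1
    push_cast at h1'
    linarith
  have hδ0 : 0 ≤ δ := by
    by_contra! hneg
    have := mul_neg_of_neg_of_pos hneg hchoose
    linarith [Nat.cast_nonneg (α := ℝ) ((Finset.powersetCard k (Finset.univ : Finset W)).filter
      fun E => E ∉ G).card]
  obtain ⟨q, hq, hq1, hcond⟩ := exists_extension_rate hk hΔ hW hNn hδ
  have hbad : ∀ e ∈ H,
      ((badMaps G e).card : ℝ) ≤ δ * (Fintype.card W : ℝ) ^ Fintype.card V := by
    intro e he
    refine le_of_mul_le_mul_right ?_ hchoose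
    have h1 := card_badMaps_mul_choose_le hGdown (hHsize e he) hkN
    have h2 := (Nat.cast_le (α := ℝ)).2 h1
    push_cast at h2
    calc _ ≤ _ := h2
      _ ≤ (Fintype.card W : ℝ) ^ Fintype.card V * (δ * (Fintype.card W).choose k) := by gcongr
      _ = _ := by ring
  have hstep := mul_card_goodMaps_le_insert hHsize hHdeg hq hq1 hδ0 hW hbad hcond
  have hle := pow_mul_card_goodMaps_le hq.le (S := Finset.univ) (fun T _ => hstep T)
    Finset.univ subset_rfl
  have hpos : 0 < (goodMaps H G (Finset.univ \ Finset.univ)).card := by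
    obtain ⟨w⟩ := Fintype.card_pos_iff.1 hW
    refine Finset.card_pos.2 ⟨fun _ => w, mem_goodMaps.2 ⟨by simp, fun e _ he => ?_⟩⟩
    rw [Finset.sdiff_self, Finset.subset_empty] at he
    simpa [he] using hempty
  have hcard : (0 : ℝ) < (goodMaps H G Finset.univ).card :=
    lt_of_lt_of_le (mul_pos (by positivity) (by exact_mod_cast hpos)) hle
  obtain ⟨φ, hφ⟩ := Finset.card_pos.1 (Nat.cast_pos.1 hcard)
  obtain ⟨hinj, hedges⟩ := mem_goodMaps.1 hφ
  exact ⟨φ, by simpa using hinj, fun e he => hedges e he (Finset.subset_univ e)⟩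
end

section
/- Let k, Δ ≥ 1 be integers and 0 < ε ≤ 1 a real number. Let H be a bipartite graph with n vertices and bipartition (A, B) such that every vertex of A has degree at most Δ and every vertex of B has degree at most k. Let G be a bipartite graph with parts V₁ and V₂, each of size at least 16·Δ^{1/k}·ε^{−k}·n, with at least ε·|V₁|·|V₂| edges. Then H is a subgraph of G, i.e., there is an injective map from the vertices of H to the vertices of G sending edges of H to edges of G. -/
open Finset

/-- The total weight `w` of the sets `R ∩ N u₁ ∩ ⋯ ∩ N u_d`, summed over all tuples
`(u₁, …, u_d)` of elements of `U`. -/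
noncomputable def tupleWeight {β γ : Type*} [DecidableEq γ] (N : β → Finset γ)
    (w : Finset γ → ℝ) (U : Finset β) : ℕ → Finset γ → ℝ
  | 0, R => w R
  | d + 1, R => ∑ u ∈ U, tupleWeight N w U d (R ∩ N u)

section TupleWeight

variable {α β γ : Type*} [DecidableEq γ] {N : β → Finset γ} {w : Finset γ → ℝ} {U : Finset β}

lemma tupleWeight_nonneg (hw : ∀ R, 0 ≤ w R) (d : ℕ) (R : Finset γ) :
    0 ≤ tupleWeight N w U d R := by
  induction d generalizing R with
  | zero => exact hw R
  | succ d ih => exact sum_nonneg fun u _ => ih _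

lemma tupleWeight_anti {T : Finset γ} (hT : ∀ u ∈ U, T ⊆ N u)
    (hw : ∀ R R', T ⊆ R' → R' ⊆ R → w R ≤ w R') (d : ℕ) {R R' : Finset γ} (hTR : T ⊆ R')
    (hR : R' ⊆ R) : tupleWeight N w U d R ≤ tupleWeight N w U d R' := by
  induction d generalizing R R' with
  | zero => exact hw R R' hTR hR
  | succ d ih =>
    exact sum_le_sum fun u hu =>
      ih (subset_inter hTR (hT u hu)) (inter_subset_inter hR (Subset.refl _))

lemma card_mul_tupleWeight_le {T : Finset γ} (hT : ∀ u ∈ U, T ⊆ N u)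
    (hw : ∀ R R', T ⊆ R' → R' ⊆ R → w R ≤ w R') (d : ℕ) {R : Finset γ} (hTR : T ⊆ R) :
    #U * tupleWeight N w U d R ≤ tupleWeight N w U (d + 1) R := by
  rw [← nsmul_eq_mul]
  exact card_nsmul_le_sum _ _ _ fun u hu =>
    tupleWeight_anti hT hw d (subset_inter hTR (hT u hu)) inter_subset_left

lemma pow_mul_tupleWeight_le {T : Finset γ} (hT : ∀ u ∈ U, T ⊆ N u) (hw0 : ∀ R, 0 ≤ w R)
    (hw : ∀ R R', T ⊆ R' → R' ⊆ R → w R ≤ w R') {c : ℝ} (hc : 0 ≤ c) (hcU : 1 ≤ c * #U)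
    {R : Finset γ} (hTR : T ⊆ R) {d k : ℕ} (hdk : d ≤ k) :
    c ^ d * tupleWeight N w U d R ≤ c ^ k * tupleWeight N w U k R := by
  induction k, hdk using Nat.le_induction with
  | base => exact le_rfl
  | succ k _ ih =>
    refine ih.trans ?_
    have h0 : 0 ≤ c ^ k * tupleWeight N w U k R :=
      mul_nonneg (pow_nonneg hc k) (tupleWeight_nonneg hw0 k R)
    calc c ^ k * tupleWeight N w U k R
        ≤ (c * #U) * (c ^ k * tupleWeight N w U k R) := le_mul_of_one_le_left h0 hcU
      _ = c ^ (k + 1) * (#U * tupleWeight N w U k R) := by ring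
      _ ≤ _ := mul_le_mul_of_nonneg_left (card_mul_tupleWeight_le hT hw k hTR)
          (pow_nonneg hc _)

/-- Greedy placement: the points of `P` can be sent injectively into `U` so that the sets
`D b` acquire common neighbourhoods of small total weight. -/
lemma exists_injOn_sum_tupleWeight_le {ι : Type*} [DecidableEq α] [DecidableEq β]
    (hw0 : ∀ R, 0 ≤ w R) (B : Finset ι) (D : ι → Finset α) (S : Finset γ) (P : Finset α)
    (hU : U.Nonempty) (hP : 2 * #P ≤ #U) :
    ∃ f : α → β, Set.InjOn f P ∧ (∀ a ∈ P, f a ∈ U) ∧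
      ∑ b ∈ B, (2 / #U : ℝ) ^ #(D b \ P) * tupleWeight N w U #(D b \ P)
          {x ∈ S | ∀ a ∈ D b, a ∈ P → x ∈ N (f a)} ≤
        ∑ b ∈ B, (2 / #U : ℝ) ^ #(D b) * tupleWeight N w U #(D b) S := by
  have hU0 : (0 : ℝ) < #U := by exact_mod_cast hU.card_pos
  induction P using Finset.induction_on with
  | empty => exact ⟨fun _ => hU.choose, by simp, by simp, by simp⟩
  | insert a P ha ih =>
    rw [card_insert_of_notMem ha] at hP
    obtain ⟨f, hinj, hmaps, hsum⟩ := ih (by lia)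
    set V := U \ P.image f with hV
    have hVcard : #U ≤ 2 * #V := by
      have h1 := le_card_sdiff (P.image f) U
      have h2 : #(P.image f) ≤ #P := card_image_le
      rw [← hV] at h1
      lia
    have hVne : V.Nonempty := by
      rw [← card_pos]; have := hU.card_pos; lia
    have hVcard' : (#U : ℝ) ≤ 2 * #V := by exact_mod_cast hVcard
    set c : ℝ := 2 / #U with hc
    have hc0 : 0 ≤ c := by positivity
    set F : (α → β) → Finset α → ι → ℝ := fun f P b => c ^ #(D b \ P) *
      tupleWeight N w U #(D b \ P) {x ∈ S | ∀ a ∈ D b, a ∈ P → x ∈ N (f a)} with hF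
    have key : ∀ b ∈ B, ∑ u ∈ V, F (Function.update f a u) (insert a P) b ≤
        #V * F f P b := by
      intro b _
      by_cases hab : a ∈ D b
      · have hcard : #(D b \ P) = #(D b \ insert a P) + 1 := by
          rw [← insert_erase (show a ∈ D b \ P by simp [hab, ha]),
            card_insert_of_notMem (notMem_erase _ _)]
          congr 2
          ext x; simp only [mem_erase, mem_sdiff, mem_insert]; tauto
        have hset : ∀ u, ({x ∈ S | ∀ a' ∈ D b, a' ∈ insert a P →
              x ∈ N (Function.update f a u a')} : Finset γ) =
            {x ∈ S | ∀ a ∈ D b, a ∈ P → x ∈ N (f a)} ∩ N u := by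
          intro u
          ext x
          simp only [mem_filter, mem_inter, mem_insert]
          constructor
          · rintro ⟨hx, h⟩
            refine ⟨⟨hx, fun a' h1 h2 => ?_⟩, ?_⟩
            · have := h a' h1 (Or.inr h2)
              rwa [Function.update_of_ne (by rintro rfl; exact ha h2)] at this
            · simpa using h a hab (Or.inl rfl)
          · rintro ⟨⟨hx, h⟩, hu⟩
            refine ⟨hx, fun a' h1 h2 => ?_⟩
            by_cases haa : a' = a
            · subst haa; simpa using hu
            · rw [Function.update_of_ne haa]
              exact h a' h1 (h2.resolve_left haa)
        simp only [hF, hset, hcard]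
        set m := #(D b \ insert a P)
        set R : Finset γ := {x ∈ S | ∀ a ∈ D b, a ∈ P → x ∈ N (f a)}
        rw [← mul_sum]
        have h1 : ∑ u ∈ V, tupleWeight N w U m (R ∩ N u) ≤ tupleWeight N w U (m + 1) R :=
          sum_le_sum_of_subset_of_nonneg sdiff_subset
            fun u _ _ => tupleWeight_nonneg hw0 m _
        have h2 : 1 ≤ #V * c := by
          rw [hc, ← mul_div_assoc, le_div_iff₀ hU0]; linarith
        have h3 : 0 ≤ c ^ m * tupleWeight N w U (m + 1) R :=
          mul_nonneg (pow_nonneg hc0 _) (tupleWeight_nonneg hw0 _ _)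
        calc c ^ m * ∑ u ∈ V, tupleWeight N w U m (R ∩ N u)
            ≤ c ^ m * tupleWeight N w U (m + 1) R :=
              mul_le_mul_of_nonneg_left h1 (pow_nonneg hc0 _)
          _ ≤ (#V * c) * (c ^ m * tupleWeight N w U (m + 1) R) :=
              le_mul_of_one_le_left h3 h2
          _ = _ := by ring
      · have hcard : D b \ insert a P = D b \ P := by
          ext x
          simp only [mem_sdiff, mem_insert]
          constructor
          · tauto
          · rintro ⟨h1, h2⟩
            exact ⟨h1, by rintro (rfl | h) <;> tauto⟩
        have hset : ∀ u, ({x ∈ S | ∀ a' ∈ D b, a' ∈ insert a P →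
              x ∈ N (Function.update f a u a')} : Finset γ) =
            {x ∈ S | ∀ a ∈ D b, a ∈ P → x ∈ N (f a)} := by
          intro u
          refine filter_congr fun x _ => forall₂_congr fun a' h1 => ?_
          have : a' ≠ a := by rintro rfl; exact hab h1
          simp [this]
        simp only [hF, hset, hcard, sum_const, nsmul_eq_mul, le_refl]
    obtain ⟨u, hu, hle⟩ : ∃ u ∈ V, ∑ b ∈ B, F (Function.update f a u) (insert a P) b ≤
        ∑ b ∈ B, F f P b := by
      apply exists_le_of_sum_le hVne
      rw [sum_comm, sum_const, nsmul_eq_mul, mul_sum]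
      exact sum_le_sum key
    have hu' : u ∈ U ∧ ∀ x ∈ P, f x ≠ u := by simpa [hV] using hu
    have hne : ∀ x ∈ P, x ≠ a := by rintro x hx rfl; exact ha hx
    refine ⟨Function.update f a u, ?_, ?_, hle.trans hsum⟩
    · rw [coe_insert, Set.injOn_insert (by simpa using ha)]
      constructor
      · intro x hx y hy hxy
        rw [Function.update_of_ne (hne x hx), Function.update_of_ne (hne y hy)] at hxy
        exact hinj hx hy hxy
      · rintro ⟨x, hx, hxu⟩
        rw [Function.update_of_ne (hne x hx), Function.update_self] at hxu
        exact hu'.2 x hx hxu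
    · intro x hx
      rcases mem_insert.1 hx with rfl | hx
      · simpa using hu'.1
      · rw [Function.update_of_ne (hne x hx)]
        exact hmaps x hx

/-- Averaging of `tupleWeight` over the common neighbourhoods of all `k`-tuples in `R`. -/
lemma sum_piFinset_tupleWeight_le {V : Finset β} {k : ℕ} {C : ℝ}
    (hw : ∀ R : Finset γ, (#R : ℝ) ^ k * w R ≤ C) (d : ℕ) (R : Finset γ) :
    ∑ T ∈ Fintype.piFinset (fun _ : Fin k => R),
      tupleWeight N w {u ∈ V | ∀ i, T i ∈ N u} d R ≤ #V ^ d * C := by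
  induction d generalizing R with
  | zero => simpa [tupleWeight] using hw R
  | succ d ih =>
    simp only [tupleWeight]
    rw [sum_comm' (t' := V) (s' := fun u => Fintype.piFinset (fun _ : Fin k => R ∩ N u))
      (by intro T u; simp only [Fintype.mem_piFinset, mem_filter, mem_inter, forall_and]; tauto)]
    calc _ ≤ ∑ u ∈ V, (#V : ℝ) ^ d * C := sum_le_sum fun u _ => ih _
      _ = _ := by rw [sum_const, nsmul_eq_mul]; ring

lemma mul_pow_succ_le_sum {ι : Type*} {s : Finset ι} {f : ι → ℝ} (hf : ∀ i ∈ s, 0 ≤ f i) {E : ℝ}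
    (hE : 0 ≤ E) (hs : s.Nonempty) (h : #s * E ≤ ∑ i ∈ s, f i) (m : ℕ) :
    #s * E ^ (m + 1) ≤ ∑ i ∈ s, f i ^ (m + 1) := by
  have hs0 : (0 : ℝ) < #s := by exact_mod_cast hs.card_pos
  refine le_trans ?_ (pow_sum_div_card_le_sum_pow hf m)
  rw [le_div_iff₀ (by positivity)]
  calc #s * E ^ (m + 1) * (#s : ℝ) ^ m = (#s * E) ^ (m + 1) := by ring
    _ ≤ _ := pow_le_pow_left₀ (by positivity) h _

/-- Power means applied to the sizes of common neighbourhoods. -/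
lemma le_sum_piFinset_card_pow {V : Finset β} {S : Finset γ} {k : ℕ} (hk : k ≠ 0) {ε : ℝ}
    (hε : 0 ≤ ε) (hS : S.Nonempty) (hVne : V.Nonempty) (hN : ∀ u, N u ⊆ S)
    (hdense : ε * #S * #V ≤ ∑ u ∈ V, (#(N u) : ℝ)) :
    (#S : ℝ) ^ k * (ε ^ k * #V) ^ k ≤
      ∑ T ∈ Fintype.piFinset (fun _ : Fin k => S),
        (#{u ∈ V | ∀ i, T i ∈ N u} : ℝ) ^ k := by
  obtain ⟨m, rfl⟩ := Nat.exists_eq_succ_of_ne_zero hk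
  have hS0 : (0 : ℝ) < #S := by exact_mod_cast hS.card_pos
  have hV0 : (0 : ℝ) < #V := by exact_mod_cast hVne.card_pos
  have hcount : ∑ T ∈ Fintype.piFinset (fun _ : Fin (m + 1) => S),
      (#{u ∈ V | ∀ i, T i ∈ N u} : ℝ) = ∑ u ∈ V, (#(N u) : ℝ) ^ (m + 1) := by
    simp_rw [card_eq_sum_ones, Nat.cast_sum]
    rw [sum_comm' (t' := V) (s' := fun u => Fintype.piFinset (fun _ : Fin (m + 1) => N u))]
    · simp
    · intro T u
      simp only [Fintype.mem_piFinset, mem_filter]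
      exact ⟨fun h => ⟨h.2.2, h.2.1⟩, fun h => ⟨fun i => hN u (h.1 i), h.2, h.1⟩⟩
  have h1 : (#V : ℝ) * (ε * #S) ^ (m + 1) ≤ ∑ u ∈ V, (#(N u) : ℝ) ^ (m + 1) :=
    mul_pow_succ_le_sum (fun _ _ => Nat.cast_nonneg _) (by positivity) hVne (by linarith) m
  have hcard : (#(Fintype.piFinset fun _ : Fin (m + 1) => S) : ℝ) = (#S : ℝ) ^ (m + 1) := by
    simp
  rw [← hcount] at h1
  rw [Nat.succ_eq_add_one, ← hcard]
  refine mul_pow_succ_le_sum (fun _ _ => Nat.cast_nonneg _) (by positivity)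
    (Fintype.piFinset_nonempty.2 fun _ => hS) ?_ m
  rw [hcard]
  refine le_of_eq_of_le ?_ h1
  ring

/-- Dependent random choice. -/
lemma exists_tupleWeight_le [DecidableEq β] {V : Finset β} {S : Finset γ} {k n : ℕ} (hk : 1 ≤ k)
    (hn : 1 ≤ n) {ε : ℝ} (hε : 0 < ε) (hN : ∀ u, N u ⊆ S)
    (hdense : ε * #S * #V ≤ ∑ u ∈ V, (#(N u) : ℝ))
    (hS : 16 * n ≤ ε ^ k * #S) (hV : 16 * n ≤ ε ^ k * #V) :
    ∃ U ⊆ V, ∃ T ⊆ S, T.Nonempty ∧ (∀ u ∈ U, T ⊆ N u) ∧ 8 * n ≤ #U ∧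
      (2 / #U : ℝ) ^ k * tupleWeight N (fun R => (n / #R : ℝ) ^ k) U k S ≤ 1 / 4 := by
  have hk0 : k ≠ 0 := by lia
  have hn0 : (0 : ℝ) < n := by exact_mod_cast hn
  have hS0 : (0 : ℝ) < #S := by
    by_contra! h
    nlinarith [pow_pos hε k]
  have hV0 : (0 : ℝ) < #V := by
    by_contra! h
    nlinarith [pow_pos hε k]
  have hSne : S.Nonempty := card_pos.1 (by exact_mod_cast hS0)
  have hVne : V.Nonempty := card_pos.1 (by exact_mod_cast hV0)
  set w : Finset γ → ℝ := fun R => (n / #R : ℝ) ^ k with hw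
  have hw0 : ∀ R, 0 ≤ w R := fun R => by positivity
  have hwR : ∀ R : Finset γ, (#R : ℝ) ^ k * w R ≤ (n : ℝ) ^ k := by
    intro R
    rw [hw, ← mul_pow]
    refine pow_le_pow_left₀ (by positivity) ?_ k
    rcases eq_or_ne (#R : ℝ) 0 with h | h
    · rw [h]; simp
    · rw [mul_div_cancel₀ _ h]
  set E : ℝ := (ε ^ k * #V) ^ k with hE
  have hE16 : (16 * n : ℝ) ^ k ≤ E := pow_le_pow_left₀ (by positivity) hV k
  set X : (Fin k → γ) → ℝ := fun T => (#{u ∈ V | ∀ i, T i ∈ N u} : ℝ) ^ k with hX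
  set Y : (Fin k → γ) → ℝ := fun T => tupleWeight N w {u ∈ V | ∀ i, T i ∈ N u} k S with hY
  have hsumX : (#S : ℝ) ^ k * E ≤ ∑ T ∈ Fintype.piFinset (fun _ : Fin k => S), X T :=
    le_sum_piFinset_card_pow hk0 hε.le hSne hVne hN hdense
  have hsumY : ∑ T ∈ Fintype.piFinset (fun _ : Fin k => S), Y T ≤ #V ^ k * (n : ℝ) ^ k :=
    sum_piFinset_tupleWeight_le hwR k S
  have hYX : 16 ^ k * ((#V : ℝ) ^ k * (n : ℝ) ^ k) ≤ (#S : ℝ) ^ k * E := by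
    calc 16 ^ k * ((#V : ℝ) ^ k * (n : ℝ) ^ k) = (#V : ℝ) ^ k * (16 * n) ^ k := by ring
      _ ≤ (#V : ℝ) ^ k * (ε ^ k * #S) ^ k :=
        mul_le_mul_of_nonneg_left (pow_le_pow_left₀ (by positivity) hS k) (by positivity)
      _ = _ := by rw [hE]; ring
  obtain ⟨T, hT, hTle⟩ : ∃ T ∈ Fintype.piFinset (fun _ : Fin k => S),
      E / 2 + 16 ^ k / 2 * Y T ≤ X T := by
    apply exists_le_of_sum_le (Fintype.piFinset_nonempty.2 fun _ => hSne)
    rw [sum_add_distrib, sum_const, nsmul_eq_mul, ← mul_sum]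
    have hcard : (#(Fintype.piFinset fun _ : Fin k => S) : ℝ) = (#S : ℝ) ^ k := by simp
    rw [hcard]
    have := mul_le_mul_of_nonneg_left hsumY (show (0 : ℝ) ≤ 16 ^ k by positivity)
    linarith
  rw [Fintype.mem_piFinset] at hT
  have hY0 : 0 ≤ Y T := tupleWeight_nonneg hw0 _ _
  have h16 : (0 : ℝ) < 16 ^ k := by positivity
  have h2k : (2 : ℝ) ≤ 2 ^ k := by
    simpa using pow_le_pow_right₀ (one_le_two : (1 : ℝ) ≤ 2) hk
  set U : Finset β := {u ∈ V | ∀ i, T i ∈ N u} with hU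
  have hXU : X T = (#U : ℝ) ^ k := rfl
  have hUn : (8 * n : ℝ) ≤ #U := by
    refine le_of_pow_le_pow_left₀ hk0 (by positivity) ?_
    have h1 : (16 * n : ℝ) ^ k = 2 ^ k * (8 * n) ^ k := by rw [← mul_pow]; ring
    have h2 : (0 : ℝ) ≤ (8 * n) ^ k := by positivity
    have h3 : 0 ≤ 16 ^ k / 2 * Y T := by positivity
    nlinarith
  have hU0 : (0 : ℝ) < #U := by linarith
  refine ⟨U, filter_subset _ _, univ.image T, ?_, ?_, ?_, by exact_mod_cast hUn, ?_⟩
  · intro x hx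
    obtain ⟨i, -, rfl⟩ := mem_image.1 hx
    exact hT i
  · exact ⟨T ⟨0, hk⟩, mem_image_of_mem _ (mem_univ _)⟩
  · intro u hu x hx
    obtain ⟨i, -, rfl⟩ := mem_image.1 hx
    exact (mem_filter.1 hu).2 i
  · change (2 / #U : ℝ) ^ k * Y T ≤ 1 / 4
    rw [div_pow, div_mul_eq_mul_div, div_le_iff₀ (by positivity)]
    have h1 : (16 : ℝ) ^ k = 2 ^ k * 8 ^ k := by rw [← mul_pow]; norm_num
    have h8 : (8 : ℝ) ≤ 8 ^ k := by
      simpa using pow_le_pow_right₀ (by norm_num : (1 : ℝ) ≤ 8) hk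
    have hE0 : 0 ≤ E := by positivity
    have h4 : 16 ^ k * Y T ≤ 2 * (#U : ℝ) ^ k := by linarith
    have h5 : 0 ≤ 2 ^ k * Y T := by positivity
    rw [h1] at h4
    nlinarith

/-- Embedding of a bipartite incidence structure, given by the neighbourhoods `D b`, into a dense
one, given by the neighbourhoods `N u`. -/
lemma exists_embedding_of_dense [DecidableEq α] [DecidableEq β] {ι : Type*} [Fintype ι]
    (D : ι → Finset α) (P : Finset α) {V : Finset β} {S : Finset γ} {k n : ℕ} (hk : 1 ≤ k)
    (hn : 1 ≤ n) (hι : Fintype.card ι ≤ n) (hP : #P ≤ n) (hDP : ∀ b, D b ⊆ P)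
    (hDk : ∀ b, #(D b) ≤ k) {ε : ℝ} (hε : 0 < ε) (hN : ∀ u, N u ⊆ S)
    (hdense : ε * #S * #V ≤ ∑ u ∈ V, (#(N u) : ℝ))
    (hS : 16 * n ≤ ε ^ k * #S) (hV : 16 * n ≤ ε ^ k * #V) :
    ∃ (f : α → β) (g : ι → γ), Set.InjOn f P ∧ (∀ a ∈ P, f a ∈ V) ∧ Function.Injective g ∧
      (∀ b, g b ∈ S) ∧ ∀ b, ∀ a ∈ D b, g b ∈ N (f a) := by
  have hn0 : (0 : ℝ) < n := by exact_mod_cast hn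
  obtain ⟨U, hUV, T, hTS, hTne, hTU, hUn, hle⟩ := exists_tupleWeight_le hk hn hε hN hdense hS hV
  set w : Finset γ → ℝ := fun R => (n / #R : ℝ) ^ k with hw
  have hw0 : ∀ R, 0 ≤ w R := fun R => by positivity
  have hwanti : ∀ R R', T ⊆ R' → R' ⊆ R → w R ≤ w R' := by
    intro R R' h1 h2
    have h3 : (0 : ℝ) < #R' := by exact_mod_cast (hTne.mono h1).card_pos
    have h4 : (#R' : ℝ) ≤ #R := by exact_mod_cast card_le_card h2
    exact pow_le_pow_left₀ (by positivity) (div_le_div_of_nonneg_left hn0.le h3 h4) k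
  have hUne : U.Nonempty := card_pos.1 (by lia)
  have hU0 : (0 : ℝ) < #U := by exact_mod_cast hUne.card_pos
  obtain ⟨f, hinj, hmaps, hsum⟩ :=
    exists_injOn_sum_tupleWeight_le (N := N) hw0 univ D S P hUne (by lia)
  set R : ι → Finset γ := fun b => {x ∈ S | ∀ a ∈ D b, a ∈ P → x ∈ N (f a)} with hR
  have hTR : ∀ b, T ⊆ R b := fun b x hx =>
    mem_filter.2 ⟨hTS hx, fun a _ ha => hTU _ (hmaps a ha) hx⟩
  have hR0 : ∀ b, (0 : ℝ) < #(R b) := fun b => by exact_mod_cast (hTne.mono (hTR b)).card_pos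
  have hsumw : ∑ b, w (R b) ≤ n / 4 := by
    calc ∑ b, w (R b) ≤ ∑ b, (2 / #U : ℝ) ^ #(D b) * tupleWeight N w U #(D b) S := by
          simpa [sdiff_eq_empty_iff_subset.2 (hDP _), tupleWeight] using hsum
      _ ≤ ∑ _b : ι, (1 / 4 : ℝ) := sum_le_sum fun b _ =>
          (pow_mul_tupleWeight_le hTU hw0 hwanti (by positivity)
            (by rw [div_mul_cancel₀ _ hU0.ne']; norm_num) hTS (hDk b)).trans hle
      _ = Fintype.card ι / 4 := by simp; ring
      _ ≤ n / 4 := by gcongr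
  obtain ⟨g, hginj, hg⟩ : ∃ g : ι → γ, Function.Injective g ∧ ∀ b, g b ∈ R b := by
    rw [← all_card_le_biUnion_card_iff_exists_injective]
    intro s
    by_contra! hlt
    have hs : #s ≤ n := (card_le_univ s).trans hι
    have hs0 : (0 : ℝ) < #s := by exact_mod_cast (Nat.zero_le _).trans_lt hlt
    have h1 : ∀ b ∈ s, (n / #s : ℝ) ≤ w (R b) := by
      intro b hb
      have h2 : (#(R b) : ℝ) ≤ #s := by
        exact_mod_cast (card_le_card (subset_biUnion_of_mem R hb)).trans hlt.le
      have h3 : (n / #s : ℝ) ≤ n / #(R b) := div_le_div_of_nonneg_left hn0.le (hR0 b) h2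
      have h4 : (1 : ℝ) ≤ n / #(R b) := by
        rw [one_le_div (hR0 b)]
        exact h2.trans (by exact_mod_cast hs)
      exact h3.trans (le_self_pow₀ h4 (by lia))
    have h5 : (n : ℝ) ≤ ∑ b ∈ s, w (R b) := by
      have := card_nsmul_le_sum s _ _ h1
      rwa [nsmul_eq_mul, mul_div_cancel₀ _ hs0.ne'] at this
    have h6 : ∑ b ∈ s, w (R b) ≤ ∑ b, w (R b) :=
      sum_le_sum_of_subset_of_nonneg (subset_univ _) fun b _ _ => hw0 _
    linarith
  refine ⟨f, g, hinj, fun a ha => hUV (hmaps a ha), hginj, fun b => (mem_filter.1 (hg b)).1, ?_⟩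
  exact fun b a ha => (mem_filter.1 (hg b)).2 a ha (hDP b ha)

end TupleWeight

/-- The edges of a bipartite graph are counted by the degrees in one part. -/
lemma SimpleGraph.ncard_edgeSet_le_sum_of_bipartite {β : Type*} (G : SimpleGraph β)
    [DecidableRel G.Adj] [DecidableEq β] {V W : Finset β}
    (h : ∀ u v, G.Adj u v → (u ∈ V ∧ v ∈ W) ∨ (v ∈ V ∧ u ∈ W)) :
    G.edgeSet.ncard ≤ ∑ u ∈ W, #{x ∈ V | G.Adj u x} := by
  rw [← card_sigma]
  refine (Set.ncard_le_ncard (t := ((W.sigma fun u => {x ∈ V | G.Adj u x}).image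
    fun p => s(p.1, p.2) : Finset (Sym2 β))) ?_ (finite_toSet _)).trans ?_
  · intro e
    induction e using Sym2.ind with
    | _ u v =>
      intro huv
      rw [SimpleGraph.mem_edgeSet] at huv
      simp only [coe_image, Set.mem_image, mem_coe, mem_sigma, mem_filter]
      rcases h u v huv with ⟨hu, hv⟩ | ⟨hv, hu⟩
      · exact ⟨⟨v, u⟩, ⟨hv, hu, huv.symm⟩, Sym2.eq_swap⟩
      · exact ⟨⟨u, v⟩, ⟨hu, hv, huv⟩, rfl⟩
  · rw [Set.ncard_coe_finset]
    exact card_image_le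


/-- **Embedding bipartite graphs in dense bipartite graphs.**
Let `k, Δ ≥ 1` and `0 < ε ≤ 1`. Let `H` be a bipartite graph with `n` vertices and
bipartition `(A, B)` where every vertex of `A` has degree at most `Δ` and every vertex of
`B` has degree at most `k`. Let `G` be a bipartite graph with parts `V₁, V₂`, each of
size at least `16 · Δ^{1/k} · ε^{−k} · n`, and at least `ε·|V₁|·|V₂|` edges. Then `H` is
a subgraph of `G`. -/
theorem stmt10 {α β : Type*} [Fintype α] [Fintype β] [DecidableEq β] (k Δ n : ℕ) (hk : 1 ≤ k)
    (hΔ : 1 ≤ Δ) (ε : ℝ) (hε0 : 0 < ε) (hε1 : ε ≤ 1)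
    (H : SimpleGraph α) (hn : Fintype.card α = n) (A : Finset α)
    (hbip : ∀ u v, H.Adj u v → (u ∈ A ↔ v ∉ A))
    (hdegA : ∀ v ∈ A, (H.neighborSet v).ncard ≤ Δ)
    (hdegB : ∀ v ∉ A, (H.neighborSet v).ncard ≤ k)
    (G : SimpleGraph β) (V₁ V₂ : Finset β) (hV : Disjoint V₁ V₂)
    (hVuniv : V₁ ∪ V₂ = Finset.univ)
    (hGbip : ∀ u v, G.Adj u v → (u ∈ V₁ ↔ v ∉ V₁))
    (hV₁ : 16 * (Δ : ℝ) ^ ((1 : ℝ) / k) * ε ^ (-(k : ℝ)) * n ≤ (V₁.card : ℝ))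
    (hV₂ : 16 * (Δ : ℝ) ^ ((1 : ℝ) / k) * ε ^ (-(k : ℝ)) * n ≤ (V₂.card : ℝ))
    (hdense : ε * V₁.card * V₂.card ≤ (G.edgeSet.ncard : ℝ)) :
    ∃ φ : α → β, Function.Injective φ ∧ ∀ u v, H.Adj u v → G.Adj (φ u) (φ v) := by
  classical
  rcases Nat.eq_zero_or_pos n with rfl | hn0
  · have := Fintype.card_eq_zero_iff.1 hn
    exact ⟨isEmptyElim, fun x => isEmptyElim x, fun x => isEmptyElim x⟩
  have hsize : ∀ m : ℕ, 16 * (Δ : ℝ) ^ ((1 : ℝ) / k) * ε ^ (-(k : ℝ)) * n ≤ m →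
      16 * n ≤ ε ^ k * m := by
    intro m hm
    have h1 : (1 : ℝ) ≤ (Δ : ℝ) ^ ((1 : ℝ) / k) :=
      Real.one_le_rpow (by exact_mod_cast hΔ) (by positivity)
    have hεk : (0 : ℝ) < ε ^ k := pow_pos hε0 k
    rw [Real.rpow_neg hε0.le, Real.rpow_natCast] at hm
    calc (16 * n : ℝ) ≤ (Δ : ℝ) ^ ((1 : ℝ) / k) * (16 * n) :=
          le_mul_of_one_le_left (by positivity) h1
      _ = ε ^ k * (16 * (Δ : ℝ) ^ ((1 : ℝ) / k) * (ε ^ k)⁻¹ * n) := by field_simp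
      _ ≤ ε ^ k * m := mul_le_mul_of_nonneg_left hm hεk.le
  have hV₂mem : ∀ v, v ∉ V₁ → v ∈ V₂ := fun v hv =>
    (mem_union.1 (hVuniv ▸ mem_univ v)).resolve_left hv
  have hedges : G.edgeSet.ncard ≤ ∑ u ∈ V₂, #{x ∈ V₁ | G.Adj u x} := by
    refine G.ncard_edgeSet_le_sum_of_bipartite fun u v huv => ?_
    have h := hGbip u v huv
    by_cases hu : u ∈ V₁
    · exact Or.inl ⟨hu, hV₂mem v (h.1 hu)⟩
    · exact Or.inr ⟨by tauto, hV₂mem u hu⟩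
  obtain ⟨f, g, hf, hfV, hg, hgV, hadj⟩ := exists_embedding_of_dense
    (N := fun u => {x ∈ V₁ | G.Adj u x}) (V := V₂) (S := V₁) (n := n)
    (fun b : {b // b ∉ A} => {a | H.Adj b a}) A hk hn0 (hn ▸ Fintype.card_subtype_le _)
    (hn ▸ card_le_univ A)
    (fun b a ha => by
      have := hbip b a (by simpa using ha)
      have := b.2
      tauto)
    (fun b => by
      have h := hdegB b b.2
      rwa [← Set.ncard_coe_finset, coe_filter_univ])
    hε0 (fun u => filter_subset _ _) (hdense.trans (by exact_mod_cast hedges))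
    (hsize _ hV₁) (hsize _ hV₂)
  have hedge : ∀ u v (hv : v ∉ A), H.Adj u v → G.Adj (f u) (g ⟨v, hv⟩) := fun u v hv huv =>
    (mem_filter.1 (hadj ⟨v, hv⟩ u (by simpa using huv.symm))).2
  have hfg : ∀ a ∈ A, ∀ b, f a ≠ g b := fun a ha b h =>
    disjoint_left.1 hV (hgV b) (h ▸ hfV a ha)
  refine ⟨fun x => if hx : x ∈ A then f x else g ⟨x, hx⟩, ?_, ?_⟩
  · intro x y hxy
    by_cases hx : x ∈ A <;> by_cases hy : y ∈ A <;> simp only [hx, hy, dif_pos, dif_neg,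
      not_false_eq_true] at hxy
    · exact hf hx hy hxy
    · exact absurd hxy (hfg x hx _)
    · exact absurd hxy.symm (hfg y hy _)
    · simpa using hg hxy
  · intro u v huv
    have h := hbip u v huv
    by_cases hu : u ∈ A
    · have hv := h.1 hu
      simpa only [hu, hv, dif_pos, dif_neg, not_false_eq_true] using hedge u v hv huv
    · have hv : v ∈ A := by tauto
      simpa only [hu, hv, dif_pos, dif_neg, not_false_eq_true] using (hedge v u hu huv.symm).symm
end

section
/- Let k, Δ ≥ 1 be integers and let H be a bipartite graph with n vertices and a bipartition in which one part has maximum degree at most k and the other part has maximum degree at most Δ. Then the Ramsey number of H satisfies r(H) ≤ Δ^{1/k}·2^{k+5}·n; that is, for every integer N ≥ Δ^{1/k}·2^{k+5}·n, every red/blue coloring of the edges of the complete graph on N vertices contains a copy of H all of whose edges have the same color. -/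
open Finset in
/-- Exchanging the values of `f` on `T` with the entries of an independent tuple `y`. -/
lemma card_filter_and_image_mul_pow_le {α β : Type*} [Fintype α] [DecidableEq α] [DecidableEq β]
    (U : Finset β) (k : ℕ) (T : Finset α) (hT : #T ≤ k)
    (P : (α → β) → Prop) [DecidablePred P] (hP : ∀ f g, (∀ a ∉ T, f a = g a) → P f → P g)
    (Q : Finset β → Prop) [DecidablePred Q] (hQ : ∀ s t, s ⊆ t → Q s → Q t) :
    #{f ∈ Fintype.piFinset (fun _ : α => U) | P f ∧ Q (T.image f)} * #U ^ k ≤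
      #{f ∈ Fintype.piFinset (fun _ : α => U) | P f} *
        #{y ∈ Fintype.piFinset (fun _ : Fin k => U) | Q (univ.image y)} := by
  classical
  obtain ⟨g⟩ : Nonempty (T ↪ Fin k) :=
    Function.Embedding.nonempty_of_card_le (by simpa using hT)
  rw [← Fintype.card_piFinset_const, ← card_product, ← card_product]
  let F : (α → β) × (Fin k → β) → (α → β) × (Fin k → β) := fun p =>
    (fun a => if h : a ∈ T then p.2 (g ⟨a, h⟩) else p.1 a,
     fun i => if h : ∃ a, g a = i then p.1 h.choose else p.2 i)
  have hF1 : ∀ p (a : α) (h : a ∈ T), (F p).1 a = p.2 (g ⟨a, h⟩) := fun p a h => by simp [F, h]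
  have hF1' : ∀ p (a : α) (_ : a ∉ T), (F p).1 a = p.1 a := fun p a h => by simp [F, h]
  have hF2 : ∀ p (a : T), (F p).2 (g a) = p.1 a := by
    intro p a
    have h : ∃ a', g a' = g a := ⟨a, rfl⟩
    have : h.choose = a := g.injective h.choose_spec
    simp only [F]
    rw [dif_pos h, this]
  have hF2' : ∀ p i (_ : ¬ ∃ a, g a = i), (F p).2 i = p.2 i := by
    intro p i h
    simp only [F]
    rw [dif_neg h]
  refine card_le_card_of_injOn F ?_ ?_
  · rintro ⟨f, y⟩ hp
    simp only [coe_product, Set.mem_prod, mem_coe, mem_filter, Fintype.mem_piFinset] at hp ⊢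
    obtain ⟨⟨hf, hPf, hQf⟩, hy⟩ := hp
    refine ⟨⟨fun a => ?_, hP f _ (fun a ha => (hF1' (f, y) a ha).symm) hPf⟩, fun i => ?_,
      hQ _ _ ?_ hQf⟩
    · by_cases h : a ∈ T
      · rw [hF1 _ a h]; exact hy _
      · rw [hF1' _ a h]; exact hf _
    · by_cases h : ∃ a, g a = i
      · obtain ⟨a, rfl⟩ := h
        rw [hF2]; exact hf _
      · rw [hF2' _ i h]; exact hy _
    · intro x hx
      obtain ⟨a, ha, rfl⟩ := mem_image.1 hx
      exact mem_image.2 ⟨g ⟨a, ha⟩, mem_univ _, hF2 (f, y) ⟨a, ha⟩⟩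
  · rintro p - p' - hpp
    refine Prod.ext (funext fun a => ?_) (funext fun i => ?_)
    · by_cases h : a ∈ T
      · have := hF2 p ⟨a, h⟩
        rw [hpp, hF2] at this
        exact this.symm
      · rw [← hF1' p a h, hpp, hF1' _ a h]
    · by_cases h : ∃ a, g a = i
      · obtain ⟨⟨a, ha⟩, rfl⟩ := h
        rw [← hF1 p a ha, hpp, hF1]
      · rw [← hF2' p i h, hpp, hF2' _ i h]

open Finset in
/-- Resampling the value of `f` at `v`: a collision at `v` has probability at most `1 / |U|`. -/
lemma card_filter_and_eq_mul_le {α β : Type*} [Fintype α] [DecidableEq α] [DecidableEq β]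
    (U : Finset β) {u v : α} (huv : u ≠ v)
    (P : (α → β) → Prop) [DecidablePred P] (hP : ∀ f g, (∀ a ≠ v, f a = g a) → P f → P g) :
    #{f ∈ Fintype.piFinset (fun _ : α => U) | P f ∧ f v = f u} * #U ≤
      #{f ∈ Fintype.piFinset (fun _ : α => U) | P f} := by
  rw [← card_product]
  refine card_le_card_of_injOn (fun p => Function.update p.1 v p.2) ?_ ?_
  · rintro ⟨f, y⟩ hp
    simp only [coe_product, Set.mem_prod, mem_coe, mem_filter, Fintype.mem_piFinset] at hp ⊢
    obtain ⟨⟨hf, hPf, -⟩, hy⟩ := hp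
    refine ⟨fun a => ?_, hP f _ (fun a ha => by simp [ha]) hPf⟩
    by_cases h : a = v
    · subst h; simpa using hy
    · simpa [h] using hf a
  · rintro ⟨f, y⟩ hp ⟨f', y'⟩ hp' h
    simp only [coe_product, Set.mem_prod, mem_coe, mem_filter] at hp hp'
    have key : ∀ a ≠ v, f a = f' a := fun a ha => by simpa [ha] using congrFun h a
    have hy : y = y' := by simpa using congrFun h v
    refine Prod.ext (funext fun a => ?_) hy
    by_cases ha : a = v
    · subst ha
      change f a = f' a
      rw [hp.1.2.2, hp'.1.2.2, key u huv]
    · exact key a ha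

lemma mul_div_pow_le_div_eight {k : ℕ} (hk : 1 ≤ k) {c q u d D : ℝ} (hc : 0 ≤ c) (hq : 0 ≤ q)
    (hu : 0 < u) (hdD : d ≤ D) (h : 32 ^ k * D * q ≤ 2 * u ^ k) :
    d * (2 ^ k * c * q / u ^ k) ≤ c / 8 := by
  rw [mul_div_assoc', div_le_div_iff₀ (by positivity) (by norm_num)]
  have h16 : (16 : ℝ) ≤ 16 ^ k := le_self_pow₀ (by norm_num) (by omega)
  have h32 : (32 : ℝ) ^ k = 16 ^ k * 2 ^ k := by rw [← mul_pow]; norm_num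
  have hD : 2 ^ k * D * q * 8 ≤ u ^ k := by
    rcases le_or_gt 0 D with hD | hD
    · have : 16 * (2 ^ k * D * q) ≤ 16 ^ k * (2 ^ k * D * q) := by gcongr
      rw [h32] at h
      linarith
    · have : 2 ^ k * q * 8 * D ≤ 0 := mul_nonpos_of_nonneg_of_nonpos (by positivity) hD.le
      have : 0 < u ^ k := by positivity
      linarith
  calc d * (2 ^ k * c * q) * 8 ≤ D * (2 ^ k * c * q) * 8 := by gcongr
    _ = c * (2 ^ k * D * q * 8) := by ring
    _ ≤ c * u ^ k := by gcongr

open Finset in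
/-- Random packing: if few `k`-tuples of `U` are bad, a hypergraph with edges of size at most `k`
and maximum degree at most `Δ` embeds injectively into `U` with no edge mapped to a bad set. -/
lemma exists_injective_avoiding {α β ι : Type*} [Fintype α] [DecidableEq α] [DecidableEq β]
    [Fintype ι] (U : Finset β) (k Δ : ℕ) (hk : 1 ≤ k) (hα : 0 < Fintype.card α)
    (hU : 16 * Fintype.card α ≤ #U) (T : ι → Finset α) (hT : ∀ b, #(T b) ≤ k)
    (hΔ : ∀ v, #{b | v ∈ T b} ≤ Δ)
    (Q : Finset β → Prop) [DecidablePred Q] (hQ : ∀ s t, s ⊆ t → Q s → Q t) (hQ0 : ¬ Q ∅)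
    (hbad : 32 ^ k * Δ * #{y ∈ Fintype.piFinset (fun _ : Fin k => U) | Q (univ.image y)} ≤
      2 * #U ^ k) :
    ∃ f : α → β, Function.Injective f ∧ (∀ a, f a ∈ U) ∧ ∀ b, ¬ Q ((T b).image f) := by
  classical
  let valid : Finset α → (α → β) → Prop := fun S f =>
    Set.InjOn f S ∧ ∀ b, T b ⊆ S → ¬ Q ((T b).image f)
  have valid_congr : ∀ S f g, (∀ a ∈ S, f a = g a) → valid S f → valid S g := by
    intro S f g h hf
    refine ⟨hf.1.congr fun a ha => h a ha, fun b hb => ?_⟩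
    rw [← image_congr (f := f) fun a ha => h a (hb ha)]
    exact hf.2 b hb
  have valid_mono : ∀ S S' f, S' ⊆ S → valid S f → valid S' f := fun S S' f h hf =>
    ⟨hf.1.mono (by exact_mod_cast h), fun b hb => hf.2 b (hb.trans h)⟩
  let X : Finset (α → β) := Fintype.piFinset (fun _ : α => U)
  let c : Finset α → ℕ := fun S => #{f ∈ X | valid S f}
  let q := #{y ∈ Fintype.piFinset (fun _ : Fin k => U) | Q (univ.image y)}
  have hUpos : 0 < #U := by omega
  have hbadR : (32 ^ k * Δ * q : ℝ) ≤ 2 * #U ^ k := by exact_mod_cast hbad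
  have hstep : ∀ S : Finset α, ∀ v ∈ S, c (S.erase v) ≤ 2 * c S := by
    intro S
    induction S using Finset.strongInduction with
    | H S ih =>
    intro v hv
    set S₀ := S.erase v with hS₀
    have hv₀ : v ∉ S₀ := notMem_erase v S
    have hchain : ∀ R : Finset α, c (S₀ \ R) ≤ 2 ^ #R * c S₀ := by
      intro R
      induction R using Finset.induction_on with
      | empty => simp
      | insert a R ha ihR =>
        rw [card_insert_of_notMem ha, pow_succ]
        have h1 : c (S₀ \ insert a R) ≤ 2 * c (S₀ \ R) := by
          rw [sdiff_insert]
          by_cases haS : a ∈ S₀ \ R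
          · refine ih _ ?_ a haS
            exact lt_of_le_of_lt sdiff_subset (erase_ssubset hv)
          · rw [erase_eq_of_notMem haS]; omega
        nlinarith
    have hcover : ({f ∈ X | valid S₀ f} : Finset (α → β)) ⊆ {f ∈ X | valid S f} ∪
        (S₀.biUnion (fun u => {f ∈ X | valid S₀ f ∧ f v = f u}) ∪
        (univ.filter (fun b => v ∈ T b)).biUnion
          (fun b => {f ∈ X | valid (S₀ \ T b) f ∧ Q ((T b).image f)})) := by
      intro f hf
      simp only [mem_union, mem_biUnion, mem_filter, mem_univ, true_and] at hf ⊢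
      obtain ⟨hfX, hfv⟩ := hf
      by_contra! hcon
      obtain ⟨h1, h2, h3⟩ := hcon
      refine h1 hfX ⟨?_, fun b hb => ?_⟩
      · rw [← insert_erase hv, coe_insert, Set.injOn_insert (by simp)]
        refine ⟨hfv.1, ?_⟩
        rintro ⟨u, hu, huv⟩
        exact h2 u hu hfX hfv huv.symm
      · by_cases hvb : v ∈ T b
        · exact h3 b hvb hfX (valid_mono _ _ _ sdiff_subset hfv)
        · exact hfv.2 b (subset_erase.2 ⟨hb, hvb⟩)
    have hcard : c S₀ ≤ c S + (∑ u ∈ S₀, #{f ∈ X | valid S₀ f ∧ f v = f u} +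
        ∑ b with v ∈ T b, #{f ∈ X | valid (S₀ \ T b) f ∧ Q ((T b).image f)}) :=
      (card_le_card hcover).trans <| (card_union_le _ _).trans <| Nat.add_le_add_left
        ((card_union_le _ _).trans (Nat.add_le_add card_biUnion_le card_biUnion_le)) _
    have hcoll : ∀ u ∈ S₀, (#{f ∈ X | valid S₀ f ∧ f v = f u} : ℝ) ≤ c S₀ / #U := by
      intro u hu
      rw [le_div_iff₀ (by exact_mod_cast hUpos)]
      have := card_filter_and_eq_mul_le U (u := u) (v := v) (by rintro rfl; exact hv₀ hu)
        (valid S₀) (fun f g h => valid_congr S₀ f g fun a ha => h a (by rintro rfl; exact hv₀ ha))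
      exact_mod_cast this
    have hedge : ∀ b, (#{f ∈ X | valid (S₀ \ T b) f ∧ Q ((T b).image f)} : ℝ) ≤
        2 ^ k * c S₀ * q / #U ^ k := by
      intro b
      rw [le_div_iff₀ (by positivity)]
      have h1 := card_filter_and_image_mul_pow_le U k (T b) (hT b) (valid (S₀ \ T b))
        (fun f g h => valid_congr _ f g fun a ha => h a (mem_sdiff.1 ha).2) Q hQ
      have h2 : c (S₀ \ T b) ≤ 2 ^ k * c S₀ := (hchain (T b)).trans
        (Nat.mul_le_mul_right _ (Nat.pow_le_pow_right (by norm_num) (hT b)))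
      have h3 := h1.trans (Nat.mul_le_mul_right q h2)
      exact_mod_cast h3
    have hsum1 : ∑ u ∈ S₀, (#{f ∈ X | valid S₀ f ∧ f v = f u} : ℝ) ≤ c S₀ / 16 := by
      refine (sum_le_card_nsmul _ _ _ hcoll).trans ?_
      rw [nsmul_eq_mul, mul_div_assoc', div_le_div_iff₀ (by exact_mod_cast hUpos) (by norm_num)]
      have : 16 * #S₀ ≤ #U := le_trans (Nat.mul_le_mul_left _ (card_le_univ _)) hU
      have : (16 * #S₀ : ℝ) ≤ #U := by exact_mod_cast this
      nlinarith [(Nat.cast_nonneg (c S₀) : (0 : ℝ) ≤ _)]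
    have hsum2 : ∑ b with v ∈ T b, (#{f ∈ X | valid (S₀ \ T b) f ∧ Q ((T b).image f)} : ℝ) ≤
        c S₀ / 8 := by
      refine (sum_le_card_nsmul _ _ _ fun b _ => hedge b).trans ?_
      rw [nsmul_eq_mul]
      exact mul_div_pow_le_div_eight hk (Nat.cast_nonneg _) (Nat.cast_nonneg _)
        (Nat.cast_pos.2 hUpos) (Nat.cast_le.2 (hΔ v)) hbadR
    have hcard' : (c S₀ : ℝ) ≤ c S + (∑ u ∈ S₀, (#{f ∈ X | valid S₀ f ∧ f v = f u} : ℝ) +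
        ∑ b with v ∈ T b, (#{f ∈ X | valid (S₀ \ T b) f ∧ Q ((T b).image f)} : ℝ)) := by
      exact_mod_cast hcard
    have : (c S₀ : ℝ) ≤ 2 * c S := by
      linarith [(Nat.cast_nonneg (c S₀) : (0 : ℝ) ≤ _)]
    exact_mod_cast this
  have hpos : ∀ S, 0 < c S := by
    intro S
    induction S using Finset.induction_on with
    | empty =>
      obtain ⟨u, hu⟩ := card_pos.1 hUpos
      refine card_pos.2 ⟨fun _ => u, mem_filter.2 ⟨by simp [X, hu], by simp, fun b hb => ?_⟩⟩
      rw [subset_empty.1 hb, image_empty]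
      exact hQ0
    | insert a S ha ihS =>
      have := hstep (insert a S) a (mem_insert_self _ _)
      rw [erase_insert ha] at this
      omega
  obtain ⟨f, hf⟩ := card_pos.1 (hpos univ)
  obtain ⟨hfX, hf1, hf2⟩ := mem_filter.1 hf
  exact ⟨f, by simpa [Set.injOn_univ] using hf1, by simpa [X] using hfX,
    fun b => hf2 b (subset_univ _)⟩

open Finset in
/-- Dependent random choice: in a relation of density at least `1/2` there is a large
set `U` in which only few `k`-tuples have fewer than `n` common neighbours. -/
lemma exists_few_bad_tuples {V : Type*} [Fintype V] [DecidableEq V] (R : V → V → Prop)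
    [DecidableRel R] (k Δ n : ℕ) (hk : 1 ≤ k) (hΔ : 1 ≤ Δ)
    (hn : 1 ≤ n) (hN : Δ * (2 ^ (k + 5) * n) ^ k ≤ Fintype.card V ^ k)
    (hdens : Fintype.card V ^ 2 ≤ 2 * ∑ x, #{y | R x y}) :
    ∃ U : Finset V, 16 * n ≤ #U ∧
      32 ^ k * Δ * #{y ∈ Fintype.piFinset (fun _ : Fin k => U) |
        #{z | ∀ x ∈ univ.image y, R x z} < n} ≤ 2 * #U ^ k := by
  classical
  obtain ⟨m, rfl⟩ : ∃ m, k = m + 1 := ⟨k - 1, by omega⟩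
  set k := m + 1 with hkm
  set N := Fintype.card V with hNdef
  have hNpos : 0 < N := by
    by_contra h0
    have h0 : N = 0 := by omega
    rw [h0, zero_pow (by omega)] at hN
    have : 0 < Δ * (2 ^ (k + 5) * n) ^ k := by positivity
    omega
  let U : (Fin k → V) → Finset V := fun t => {x | ∀ i, R x (t i)}
  let bad : (Fin k → V) → Prop := fun y => #{z | ∀ x ∈ univ.image y, R x z} < n
  let B : (Fin k → V) → ℕ := fun t => #{y ∈ Fintype.piFinset (fun _ : Fin k => U t) | bad y}
  have hsumU : ∑ t, #(U t) = ∑ x, #{y | R x y} ^ k := by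
    have h := sum_card_bipartiteAbove_eq_sum_card_bipartiteBelow
      (s := (univ : Finset (Fin k → V))) (t := (univ : Finset V)) (fun t x => ∀ i, R x (t i))
    refine h.trans (sum_congr rfl fun x _ => ?_)
    rw [← Fintype.card_piFinset_const]
    congr 1
    ext t
    simp [bipartiteBelow]
  have hsumB : ∑ t, B t ≤ N ^ k * n ^ k := by
    have h := sum_card_bipartiteAbove_eq_sum_card_bipartiteBelow
      (s := (univ : Finset (Fin k → V))) (t := ({y | bad y} : Finset (Fin k → V)))
      (fun t y => ∀ j i, R (y j) (t i))
    have h1 : ∑ t, B t = ∑ t ∈ (univ : Finset (Fin k → V)), #(bipartiteAbove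
        (fun t y => ∀ j i, R (y j) (t i)) ({y | bad y} : Finset (Fin k → V)) t) := by
      refine sum_congr rfl fun t _ => ?_
      simp only [B]
      congr 1
      ext y
      simp [bipartiteAbove, U, and_comm]
    rw [h1, h]
    have h2 : ∀ y ∈ ({y | bad y} : Finset (Fin k → V)), #(bipartiteBelow
        (fun t y => ∀ j i, R (y j) (t i)) (univ : Finset (Fin k → V)) y) ≤ n ^ k := by
      intro y hy
      have hy : bad y := by simpa using hy
      have : bipartiteBelow (fun t y => ∀ j i, R (y j) (t i)) (univ : Finset (Fin k → V)) y =
          Fintype.piFinset (fun _ : Fin k => ({z | ∀ x ∈ univ.image y, R x z} : Finset V)) := by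
        ext t
        simp only [bipartiteBelow, mem_filter, mem_univ, true_and, Fintype.mem_piFinset,
          mem_image, forall_exists_index, forall_apply_eq_imp_iff]
        exact forall_comm
      rw [this, Fintype.card_piFinset_const]
      exact Nat.pow_le_pow_left hy.le _
    refine (sum_le_card_nsmul _ _ _ h2).trans ?_
    rw [smul_eq_mul]
    refine Nat.mul_le_mul_right _ ((card_le_univ _).trans ?_)
    simp [hNdef]
  have hN0 : (0 : ℝ) < N := by exact_mod_cast hNpos
  have hsumU' : (N : ℝ) ^ (k + 1) / 2 ^ k ≤ ∑ t, (#(U t) : ℝ) := by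
    have h := pow_sum_div_card_le_sum_pow (s := (univ : Finset V))
      (f := fun x => (#{y | R x y} : ℝ)) (n := m) (fun x _ => by positivity)
    have h1 : ∑ t, (#(U t) : ℝ) = ∑ x, (#{y | R x y} : ℝ) ^ (m + 1) := by exact_mod_cast hsumU
    rw [h1]
    refine le_trans ?_ h
    rw [card_univ, ← hNdef, div_le_div_iff₀ (by positivity) (by positivity)]
    have h2 : (N : ℝ) ^ 2 ≤ 2 * ∑ x, (#{y | R x y} : ℝ) := by exact_mod_cast hdens
    calc (N : ℝ) ^ (k + 1) * N ^ m = (N ^ 2) ^ k := by rw [hkm]; ring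
      _ ≤ (2 * ∑ x, (#{y | R x y} : ℝ)) ^ k := by gcongr
      _ = _ := by rw [mul_pow, mul_comm]
  have hsumUk : (N : ℝ) ^ k * (N / 2 ^ k) ^ k ≤ ∑ t, (#(U t) : ℝ) ^ k := by
    have h := pow_sum_div_card_le_sum_pow (s := (univ : Finset (Fin k → V)))
      (f := fun t => (#(U t) : ℝ)) (n := m) (fun x _ => by positivity)
    refine le_trans ?_ h
    have hc : (#(univ : Finset (Fin k → V)) : ℝ) = N ^ k := by simp [hNdef]
    rw [hc, le_div_iff₀ (by positivity)]
    calc (N : ℝ) ^ k * (N / 2 ^ k) ^ k * (N ^ k) ^ m = (N ^ (k + 1) / 2 ^ k) ^ k := by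
          rw [div_pow, div_pow, hkm]; ring
      _ ≤ _ := by gcongr
  set lam : ℝ := 32 ^ k * Δ / 2 with hlam
  have hN' : (32 ^ k * Δ * n ^ k : ℝ) ≤ (N / 2 ^ k) ^ k := by
    rw [div_pow, le_div_iff₀ (by positivity)]
    have : (Δ * (2 ^ (k + 5) * n) ^ k : ℝ) ≤ N ^ k := by exact_mod_cast hN
    refine le_trans (le_of_eq ?_) this
    have h32 : (2 : ℝ) ^ (k + 5) = 2 ^ k * 32 := by rw [pow_add]; norm_num
    rw [h32, mul_pow, mul_pow]
    ring
  obtain ⟨t, -, ht⟩ : ∃ t ∈ (univ : Finset (Fin k → V)),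
      (N / 2 ^ k : ℝ) ^ k / 2 ≤ (#(U t) : ℝ) ^ k - lam * B t := by
    have : Nonempty V := Fintype.card_pos_iff.1 hNpos
    refine exists_le_of_sum_le univ_nonempty ?_
    rw [sum_sub_distrib, ← mul_sum, sum_const, nsmul_eq_mul]
    have hc : (#(univ : Finset (Fin k → V)) : ℝ) = N ^ k := by simp [hNdef]
    have hB : ∑ t, (B t : ℝ) ≤ N ^ k * n ^ k := by exact_mod_cast hsumB
    have h1 : lam * ∑ t, (B t : ℝ) ≤ N ^ k * ((N / 2 ^ k) ^ k / 2) :=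
      calc lam * ∑ t, (B t : ℝ) ≤ lam * (N ^ k * n ^ k) := by gcongr
        _ = N ^ k * (32 ^ k * Δ * n ^ k / 2) := by rw [hlam]; ring
        _ ≤ _ := by gcongr
    rw [hc]
    linarith
  refine ⟨U t, ?_, ?_⟩
  · have h1 : ((16 * n : ℕ) : ℝ) ^ k ≤ (#(U t) : ℝ) ^ k := by
      have h2 : (0 : ℝ) ≤ lam * B t := by positivity
      have h3 : (2 : ℝ) ≤ 2 ^ k := le_self_pow₀ (by norm_num) (by omega)
      have h4 : (32 : ℝ) ^ k = 16 ^ k * 2 ^ k := by rw [← mul_pow]; norm_num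
      have h5 : (1 : ℝ) ≤ Δ := by exact_mod_cast hΔ
      have h6 : (2 * (16 ^ k * n ^ k) : ℝ) ≤ 32 ^ k * Δ * n ^ k := by
        rw [h4]
        calc (2 * (16 ^ k * n ^ k) : ℝ) ≤ 2 ^ k * (16 ^ k * n ^ k) * 1 := by
              rw [mul_one]; gcongr
          _ ≤ 2 ^ k * (16 ^ k * n ^ k) * Δ := by gcongr
          _ = _ := by ring
      push_cast
      rw [mul_pow]
      linarith
    have h2 : (16 * n) ^ k ≤ #(U t) ^ k := by exact_mod_cast h1
    exact (Nat.pow_le_pow_iff_left (by omega)).1 h2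
  · have h0 : (0 : ℝ) ≤ (N / 2 ^ k : ℝ) ^ k / 2 := by positivity
    have h1 : (32 ^ k * Δ * B t : ℝ) ≤ 2 * (#(U t) : ℝ) ^ k := by
      rw [hlam] at ht
      linarith
    exact_mod_cast h1

open Finset in
/-- The more frequent colour has density at least `1 / 2` among ordered pairs, loops included. -/
lemma exists_monochromatic_density {V : Type*} [Fintype V] (c : Sym2 V → Bool) :
    ∃ b : Bool, Fintype.card V ^ 2 ≤ 2 * ∑ x, #{y | c s(x, y) = b} := by
  have h : ∑ x : V, #{y | c s(x, y) = true} + ∑ x : V, #{y | c s(x, y) = false} =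
      Fintype.card V ^ 2 := by
    rw [← sum_add_distrib, sq, ← card_univ, ← smul_eq_mul, ← sum_const]
    refine sum_congr rfl fun x _ => ?_
    simpa using card_filter_add_card_filter_not (s := (univ : Finset V)) (fun y => c s(x, y) = true)
  by_contra! hcon
  have h1 := hcon true
  have h2 := hcon false
  omega


/-- Embedding a bipartite graph between a set `U` with few bad tuples and the whole vertex set. -/
lemma exists_bipartite_embedding {α V : Type*} [Fintype α] [Fintype V] [DecidableEq V]
    (R : V → V → Prop) [DecidableRel R] (k Δ : ℕ) (hk : 1 ≤ k)
    (H : SimpleGraph α) (hα : 0 < Fintype.card α) (A : Finset α)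
    (hbip : ∀ u v, H.Adj u v → (u ∈ A ↔ v ∉ A))
    (hdegA : ∀ v ∈ A, (H.neighborSet v).ncard ≤ Δ)
    (hdegB : ∀ v ∉ A, (H.neighborSet v).ncard ≤ k)
    (hV : Fintype.card α ≤ Fintype.card V)
    (U : Finset V) (hU : 16 * Fintype.card α ≤ U.card)
    (hbad : 32 ^ k * Δ * ((Fintype.piFinset (fun _ : Fin k => U)).filter fun y =>
        (Finset.univ.filter fun z => ∀ x ∈ Finset.univ.image y, R x z).card <
          Fintype.card α).card ≤ 2 * U.card ^ k) :
    ∃ φ : α → V, Function.Injective φ ∧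
      ∀ u ∈ A, ∀ v ∉ A, H.Adj u v → R (φ u) (φ v) := by
  classical
  let T : {v // v ∉ A} → Finset α := fun v => (H.neighborSet v).toFinset
  have hTA : ∀ v, ∀ u ∈ T v, u ∈ A := fun v u hu => by
    have hadj : H.Adj v u := by simpa [T] using hu
    by_contra huA
    exact v.2 ((hbip _ _ hadj).2 huA)
  obtain ⟨f, hfinj, -, hfT⟩ := exists_injective_avoiding U k Δ hk hα hU T
    (fun v => by simpa only [T, Set.ncard_eq_toFinset_card'] using hdegB v v.2)
    (fun v => by
      by_cases hv : v ∈ A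
      · refine le_trans ?_ (hdegA v hv)
        rw [Set.ncard_eq_toFinset_card']
        refine Finset.card_le_card_of_injOn Subtype.val (fun w hw => ?_)
          Subtype.val_injective.injOn
        have hadj : H.Adj w v := by simpa [T] using hw
        simpa using hadj.symm
      · rw [Finset.filter_false_of_mem fun w _ hw => hv (hTA w v hw)]
        simp)
    (fun s => (Finset.univ.filter fun z => ∀ x ∈ s, R x z).card < Fintype.card α)
    (fun s t hst h => lt_of_le_of_lt
      (Finset.card_le_card (Finset.monotone_filter_right _ fun z _ hz x hx => hz x (hst hx))) h)
    (by simpa using hV) hbad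
  let C : α → Finset V := fun v =>
    if hv : v ∈ A then {f v} else Finset.univ.filter fun z => ∀ x ∈ (T ⟨v, hv⟩).image f, R x z
  obtain ⟨φ, hφ, hφC⟩ := (Finset.all_card_le_biUnion_card_iff_exists_injective C).1 (fun s => by
    by_cases hs : s ⊆ A
    · rw [← Finset.card_image_of_injective s hfinj]
      refine Finset.card_le_card fun x hx => ?_
      obtain ⟨a, ha, rfl⟩ := Finset.mem_image.1 hx
      exact Finset.mem_biUnion.2 ⟨a, ha, by simp [C, hs ha]⟩
    · obtain ⟨v, hvs, hvA⟩ := Finset.not_subset.1 hs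
      refine (Finset.card_le_univ s).trans (le_trans ?_
        (Finset.card_le_card (Finset.subset_biUnion_of_mem C hvs)))
      simp only [C, dif_neg hvA]
      exact not_lt.1 (hfT ⟨v, hvA⟩))
  have hφA : ∀ v ∈ A, φ v = f v := fun v hv => by simpa [C, hv] using hφC v
  refine ⟨φ, hφ, fun u hu v hv huv => ?_⟩
  have h := hφC v
  simp only [C, dif_neg hv, Finset.mem_filter] at h
  rw [hφA u hu]
  exact h.2 (f u) (Finset.mem_image_of_mem f (by simpa [T] using huv.symm))

/-- **Ramsey numbers of bipartite graphs with unbalanced degrees.**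
Let `k, Δ ≥ 1` and let `H` be a bipartite graph with `n` vertices and a bipartition in
which one part has maximum degree at most `k` and the other part has maximum degree at
most `Δ`. Then `r(H) ≤ Δ^{1/k} · 2^{k+5} · n`: for every `N ≥ Δ^{1/k} · 2^{k+5} · n`,
every red/blue coloring of the edges of `K_N` contains a monochromatic copy of `H`. -/
theorem stmt11 {α : Type*} [Fintype α] (k Δ n : ℕ) (hk : 1 ≤ k) (hΔ : 1 ≤ Δ)
    (H : SimpleGraph α) (hn : Fintype.card α = n) (A : Finset α)
    (hbip : ∀ u v, H.Adj u v → (u ∈ A ↔ v ∉ A))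
    (hdegA : ∀ v ∈ A, (H.neighborSet v).ncard ≤ Δ)
    (hdegB : ∀ v ∉ A, (H.neighborSet v).ncard ≤ k) :
    ∀ N : ℕ, (Δ : ℝ) ^ ((1 : ℝ) / k) * 2 ^ (k + 5) * n ≤ (N : ℝ) →
      ∀ c : Sym2 (Fin N) → Bool, ∃ (b : Bool) (φ : α → Fin N),
        Function.Injective φ ∧ ∀ u v, H.Adj u v → c s(φ u, φ v) = b := by
  classical
  intro N hN c
  rcases Nat.eq_zero_or_pos n with rfl | hnpos
  · have : IsEmpty α := Fintype.card_eq_zero_iff.1 hn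
    exact ⟨true, isEmptyElim, fun a => isEmptyElim a, fun a => isEmptyElim a⟩
  subst hn
  set n := Fintype.card α with hn
  have hNpow : Δ * (2 ^ (k + 5) * n) ^ k ≤ N ^ k := by
    have h1 := pow_le_pow_left₀ (by positivity) hN k
    have h2 : ((Δ : ℝ) ^ ((1 : ℝ) / k)) ^ k = Δ := by
      rw [one_div, Real.rpow_inv_natCast_pow (by positivity) (by omega)]
    rw [mul_assoc, mul_pow, h2] at h1
    exact_mod_cast h1
  have hnN : n ≤ N := by
    refine (Nat.pow_le_pow_iff_left (n := k) (by omega)).1 (le_trans ?_ hNpow)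
    calc n ^ k ≤ (2 ^ (k + 5) * n) ^ k :=
          Nat.pow_le_pow_left (Nat.le_mul_of_pos_left _ (by positivity)) _
      _ ≤ _ := Nat.le_mul_of_pos_left _ hΔ
  obtain ⟨b, hb⟩ := exists_monochromatic_density c
  let R : Fin N → Fin N → Prop := fun x y => c s(x, y) = b
  obtain ⟨U, hU, hbad⟩ := exists_few_bad_tuples R k Δ n hk hΔ hnpos (by rwa [Fintype.card_fin]) (by convert hb)
  obtain ⟨φ, hφ, hmain⟩ := exists_bipartite_embedding R k Δ hk H hnpos A hbip hdegA hdegB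
    (by rwa [Fintype.card_fin]) U hU hbad
  refine ⟨b, φ, hφ, fun u v huv => ?_⟩
  by_cases hu : u ∈ A
  · exact hmain u hu v ((hbip u v huv).1 hu) huv
  · rw [Sym2.eq_swap]
    exact hmain v (by_contra fun hv => hu ((hbip u v huv).2 hv)) u hu huv.symm
end

section
/- For every bipartite graph H on n vertices with maximum degree Δ, the Ramsey number of H satisfies r(H) ≤ 2^{Δ+6}·n; that is, for every integer N ≥ 2^{Δ+6}·n, every red/blue coloring of the edges of the complete graph on N vertices contains a copy of H all of whose edges have the same color. -/
open Finset Function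

namespace BipartiteRamsey

/-- The power mean inequality, cleared of denominators. -/
lemma pow_sum_le_card_pow_mul_sum_pow {ι : Type*} (s : Finset ι) (f : ι → ℝ)
    (hf : ∀ i ∈ s, 0 ≤ f i) (m : ℕ) :
    (∑ i ∈ s, f i) ^ (m + 1) ≤ (#s : ℝ) ^ m * ∑ i ∈ s, f i ^ (m + 1) := by
  rcases s.eq_empty_or_nonempty with rfl | hs
  · simp
  have h := pow_sum_div_card_le_sum_pow hf m
  have hc : (0 : ℝ) < (#s : ℝ) ^ m := by
    have := hs.card_pos
    positivity
  rw [div_le_iff₀ hc] at h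
  linarith

/-- A family of nonempty finite sets whose reciprocal sizes sum to at most `1` has a system of
distinct representatives. -/
lemma exists_injective_of_sum_inv_card_le_one {ι κ : Type*} [Fintype ι] [DecidableEq κ]
    (t : ι → Finset κ) (ht : ∀ i, (t i).Nonempty) (hsum : ∑ i, (#(t i) : ℝ)⁻¹ ≤ 1) :
    ∃ h : ι → κ, Injective h ∧ ∀ i, h i ∈ t i := by
  rw [← all_card_le_biUnion_card_iff_exists_injective]
  intro s
  rcases s.eq_empty_or_nonempty with rfl | ⟨i₀, hi₀⟩
  · simp
  have hle : ∀ i ∈ s, #(t i) ≤ #(s.biUnion t) := fun i hi =>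
    card_le_card (subset_biUnion_of_mem t hi)
  have hpos : 0 < #(s.biUnion t) := (ht i₀).card_pos.trans_le (hle i₀ hi₀)
  have h1 : (#s : ℝ) * (#(s.biUnion t) : ℝ)⁻¹ ≤ 1 := by
    calc (#s : ℝ) * (#(s.biUnion t) : ℝ)⁻¹ = ∑ i ∈ s, (#(s.biUnion t) : ℝ)⁻¹ := by simp
      _ ≤ ∑ i ∈ s, (#(t i) : ℝ)⁻¹ := by
        refine sum_le_sum fun i hi => ?_
        have h0 := (ht i).card_pos
        have h2 := hle i hi
        gcongr
      _ ≤ ∑ i, (#(t i) : ℝ)⁻¹ :=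
        sum_le_sum_of_subset_of_nonneg (subset_univ _) fun _ _ _ => by positivity
      _ ≤ 1 := hsum
  have hpos' : (0 : ℝ) < #(s.biUnion t) := by exact_mod_cast hpos
  rw [← div_eq_mul_inv, div_le_one hpos'] at h1
  exact_mod_cast h1

/-- Every embedding `X ↪ U` extends along `e : X ↪ Y` to the same number of embeddings
`Y ↪ U`. -/
lemma sum_embedding_comp {X Y U : Type*} [Fintype X] [Fintype Y] [Fintype U]
    [DecidableEq X] [DecidableEq Y] [DecidableEq U] (e : X ↪ Y) (g : (X ↪ U) → ℝ) :
    ∑ f : Y ↪ U, g (e.trans f) =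
      ((Fintype.card U - Fintype.card X).descFactorial (Fintype.card Y - Fintype.card X) : ℝ) *
        ∑ S : X ↪ U, g S := by
  classical
  let ε : X ⊕ ↥(Set.range e)ᶜ ≃ Y :=
    (Equiv.sumCongr (Equiv.ofInjective e e.injective) (Equiv.refl _)).trans
      (Equiv.Set.sumCompl (Set.range e))
  let E : (Y ↪ U) ≃ Σ f : X ↪ U, ↥(Set.range e)ᶜ ↪ ↥(Set.range f)ᶜ :=
    (Equiv.embeddingCongr ε.symm (Equiv.refl U)).trans
      Equiv.sumEmbeddingEquivSigmaEmbeddingRestricted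
  have hE : ∀ f, (E f).1 = e.trans f := by
    intro f
    ext x
    rfl
  calc ∑ f : Y ↪ U, g (e.trans f) = ∑ f : Y ↪ U, g (E f).1 := by simp only [hE]
    _ = ∑ p : Σ f : X ↪ U, ↥(Set.range e)ᶜ ↪ ↥(Set.range f)ᶜ, g p.1 :=
      Equiv.sum_comp E fun p => g p.1
    _ = _ := by
      rw [Fintype.sum_sigma, mul_sum]
      refine sum_congr rfl fun S _ => ?_
      have h1 : Fintype.card ↥(Set.range e)ᶜ = Fintype.card Y - Fintype.card X := by
        rw [Fintype.card_compl_set, Set.card_range_of_injective e.injective]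
      have h2 : Fintype.card ↥(Set.range S)ᶜ = Fintype.card U - Fintype.card X := by
        rw [Fintype.card_compl_set, Set.card_range_of_injective S.injective]
      simp only
      rw [sum_const, card_univ, Fintype.card_embedding_eq, h1, h2, nsmul_eq_mul]

section CommonNeighbors

variable {V W : Type*} [Fintype W] (R : V → W → Prop)

open Classical in
/-- The elements of `W` related to every entry of the tuple `S`. -/
noncomputable def commonNbrs {ι : Type*} (S : ι → V) : Finset W := {w | ∀ i, R (S i) w}

lemma mem_commonNbrs {ι : Type*} {S : ι → V} {w : W} :
    w ∈ commonNbrs R S ↔ ∀ i, R (S i) w := by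
  simp [commonNbrs]

lemma card_tuples_related {ι κ : Type*} [Fintype κ] [DecidableEq κ] (S : ι → V)
    [DecidablePred fun T : κ → W => ∀ i j, R (S i) (T j)] :
    #{T : κ → W | ∀ i j, R (S i) (T j)} = #(commonNbrs R S) ^ Fintype.card κ := by
  have h : ({T : κ → W | ∀ i j, R (S i) (T j)} : Finset (κ → W)) =
      Fintype.piFinset fun _ => commonNbrs R S := by
    ext T
    simp only [mem_filter, mem_univ, true_and, Fintype.mem_piFinset, mem_commonNbrs]
    exact forall_comm
  rw [h, Fintype.card_piFinset, prod_const, card_univ]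

open Classical in
/-- Dependent random choice: a relation of density at least `1 / 2` between two sets of size `M`
admits a set `U` of size about `M / 2 ^ k` on which the `k`-th moment of the reciprocal of the
number of common neighbors of a `k`-tuple is small. -/
lemma exists_set_of_density [Fintype V] (k M : ℕ) (hk : 0 < k) (hM : 0 < M)
    (hV : Fintype.card V = M) (hW : Fintype.card W = M) (hR : M ^ 2 ≤ 2 * #{p : V × W | R p.1 p.2}) :
    ∃ U : Finset V, ((M : ℝ) / 2 ^ k) ^ k ≤ 2 * (#U : ℝ) ^ k ∧
      (∀ S : Fin k → V, (∀ i, S i ∈ U) → (commonNbrs R S).Nonempty) ∧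
      ((M : ℝ) / 2 ^ k) ^ k *
        ∑ S ∈ Fintype.piFinset fun _ : Fin k => U, ((#(commonNbrs R S) : ℝ)⁻¹) ^ k ≤
          2 * (#U : ℝ) ^ k := by
  obtain ⟨m, rfl⟩ : ∃ m, k = m + 1 := ⟨k - 1, by omega⟩
  set k := m + 1 with hkm
  have hM' : (0 : ℝ) < M := by exact_mod_cast hM
  let U : (Fin k → W) → Finset V := fun T => {v | ∀ j, R v (T j)}
  let g : (Fin k → V) → ℝ := fun S => ((#(commonNbrs R S) : ℝ)⁻¹) ^ k
  set Q : ℝ := ((M : ℝ) / 2 ^ k) ^ k with hQ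
  have hQ0 : 0 ≤ Q := by positivity
  have hmemU : ∀ T v, v ∈ U T ↔ ∀ j, R v (T j) := by simp [U]
  let deg : V → ℝ := fun v => #{w | R v w}
  have hdeg : (M : ℝ) ^ 2 / 2 ≤ ∑ v, deg v := by
    have h1 : #{p : V × W | R p.1 p.2} = ∑ v, #{w | R v w} := by
      simp only [card_filter]
      rw [← univ_product_univ, sum_product]
    rw [h1] at hR
    have h2 : (M : ℝ) ^ 2 ≤ 2 * ∑ v, deg v := by
      simp only [deg]
      exact_mod_cast hR
    linarith
  have hsumU : ∑ T, (#(U T) : ℝ) = ∑ v, deg v ^ k := by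
    have h1 : ∀ v, deg v ^ k = ∑ T : Fin k → W, if ∀ j, R v (T j) then (1 : ℝ) else 0 := by
      intro v
      have h2 := card_tuples_related (κ := Fin k) R (fun _ : Unit => v)
      have h3 : commonNbrs R (fun _ : Unit => v) = ({w | R v w} : Finset W) := by
        ext w
        simp [mem_commonNbrs]
      rw [h3, Fintype.card_fin] at h2
      simp only [deg]
      rw [sum_boole, ← Nat.cast_pow, ← h2]
      congr 2
      ext T
      simp
    simp only [h1]
    rw [sum_comm]
    refine sum_congr rfl fun T _ => ?_
    rw [sum_boole]
  have hcardT : (#(univ : Finset (Fin k → W)) : ℝ) = (M : ℝ) ^ k := by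
    simp [hW]
  have hlow1 : (M : ℝ) ^ (k + 1) / 2 ^ k ≤ ∑ T, (#(U T) : ℝ) := by
    have h1 := pow_sum_le_card_pow_mul_sum_pow univ deg (fun _ _ => by positivity) m
    rw [card_univ, hV, ← hkm, ← hsumU] at h1
    have h2 : ((M : ℝ) ^ 2 / 2) ^ k ≤ (∑ v, deg v) ^ k := by gcongr
    have h3 : ((M : ℝ) ^ 2 / 2) ^ k = (M : ℝ) ^ m * ((M : ℝ) ^ (k + 1) / 2 ^ k) := by
      rw [div_pow, mul_div_assoc']
      congr 1
      rw [hkm]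
      ring
    rw [h3] at h2
    exact le_of_mul_le_mul_left (h2.trans h1) (by positivity)
  have hlow2 : (M : ℝ) ^ k * Q ≤ ∑ T, (#(U T) : ℝ) ^ k := by
    have h1 := pow_sum_le_card_pow_mul_sum_pow univ (fun T => (#(U T) : ℝ))
      (fun _ _ => by positivity) m
    rw [hcardT, ← hkm] at h1
    have h2 : ((M : ℝ) ^ (k + 1) / 2 ^ k) ^ k ≤ (∑ T, (#(U T) : ℝ)) ^ k := by gcongr
    have h3 : ((M : ℝ) ^ (k + 1) / 2 ^ k) ^ k = ((M : ℝ) ^ k) ^ m * ((M : ℝ) ^ k * Q) := by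
      rw [hQ, pow_succ (M : ℝ) k, mul_div_assoc, mul_pow, ← mul_assoc, ← pow_succ]
    rw [h3] at h2
    exact le_of_mul_le_mul_left (h2.trans h1) (by positivity)
  have hup : ∑ T, ∑ S ∈ Fintype.piFinset fun _ : Fin k => U T, g S ≤ (M : ℝ) ^ k := by
    have h1 : ∀ T, ∑ S ∈ Fintype.piFinset fun _ : Fin k => U T, g S =
        ∑ S : Fin k → V, if ∀ i j, R (S i) (T j) then g S else 0 := by
      intro T
      rw [← sum_filter]
      refine sum_congr ?_ fun _ _ => rfl
      ext S
      simp [hmemU]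
    simp only [h1]
    rw [sum_comm]
    have h2 : ∀ S : Fin k → V,
        (∑ T : Fin k → W, if ∀ i j, R (S i) (T j) then g S else 0) ≤ 1 := by
      intro S
      rw [← sum_filter, sum_const, card_tuples_related, Fintype.card_fin, nsmul_eq_mul]
      simp only [g]
      push_cast
      rw [← mul_pow]
      exact pow_le_one₀ (by positivity) mul_inv_le_one
    calc _ ≤ ∑ S : Fin k → V, (1 : ℝ) := sum_le_sum fun S _ => h2 S
      _ = (M : ℝ) ^ k := by simp [hV]
  obtain ⟨T, -, hT⟩ : ∃ T ∈ (univ : Finset (Fin k → W)),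
      Q + Q * ∑ S ∈ Fintype.piFinset fun _ : Fin k => U T, g S ≤ 2 * (#(U T) : ℝ) ^ k := by
    refine exists_le_of_sum_le ?_ ?_
    · have : Nonempty W := Fintype.card_pos_iff.mp (by omega)
      exact univ_nonempty
    · rw [sum_add_distrib, sum_const, nsmul_eq_mul, hcardT, ← mul_sum, ← mul_sum]
      nlinarith [mul_le_mul_of_nonneg_left hup hQ0]
  have hg : 0 ≤ ∑ S ∈ Fintype.piFinset fun _ : Fin k => U T, g S :=
    sum_nonneg fun S _ => by positivity
  refine ⟨U T, by nlinarith [mul_nonneg hQ0 hg], fun S hS => ⟨T 0, ?_⟩, by linarith⟩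
  rw [mem_commonNbrs]
  exact fun i => (hmemU T _).1 (hS i) 0

lemma pow_mul_le_of_moment_le {x y z s : ℝ} {k : ℕ} (hk : 0 < k) (hx : 0 ≤ x) (hs : 0 ≤ s)
    (hmom : (32 * x) ^ k * s ≤ 2 * y ^ k) (hyz : y ^ k ≤ 2 ^ k * z) : x ^ k * s ≤ z := by
  have h2 : (2 : ℝ) ≤ 2 ^ k := le_self_pow₀ (by norm_num) hk.ne'
  have h8 : (1 : ℝ) ≤ 8 ^ k := one_le_pow₀ (by norm_num)
  have h32 : (32 * x) ^ k = 2 ^ k * (2 ^ k * (8 ^ k * x ^ k)) := by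
    simp only [← mul_pow]
    ring
  have h : 2 ^ k * (2 * (x ^ k * s)) ≤ 2 ^ k * (2 * z) :=
    calc 2 ^ k * (2 * (x ^ k * s)) = 2 ^ k * (2 * (1 * x ^ k)) * s := by ring
      _ ≤ 2 ^ k * (2 ^ k * (8 ^ k * x ^ k)) * s := by gcongr
      _ = (32 * x) ^ k * s := by rw [h32]
      _ ≤ 2 * y ^ k := hmom
      _ ≤ 2 ^ k * (2 * z) := by linarith
  have h' := le_of_mul_le_mul_left h (by positivity)
  linarith

open Classical in
/-- If every element `b` of a set of size `n` comes with an injective `k`-tuple `e b`, then a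
relation of density at least `1 / 2` between sets of size `2 ^ (k + 5) * n` admits injections
`f`, `h` such that `h b` is related to the `f`-image of every entry of `e b`. -/
lemma exists_embedding_of_density [Fintype V] {α : Type*} [Fintype α] (k n M : ℕ) (hk : 0 < k)
    (hkn : k ≤ n) (hα : Fintype.card α = n) (hM : M = 2 ^ (k + 5) * n)
    (hV : Fintype.card V = M) (hW : Fintype.card W = M)
    (hR : M ^ 2 ≤ 2 * #{p : V × W | R p.1 p.2}) (e : α → Fin k ↪ α) :
    ∃ (f : α → V) (h : α → W), Injective f ∧ Injective h ∧ ∀ b i, R (f (e b i)) (h b) := by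
  have hn : 0 < n := by omega
  have hn' : (0 : ℝ) < n := by exact_mod_cast hn
  obtain ⟨U, hU, hne, hmom⟩ :=
    exists_set_of_density R k M hk (by rw [hM]; positivity) hV hW hR
  have hMk : (M : ℝ) / 2 ^ k = 32 * n := by
    rw [hM, div_eq_iff (by positivity)]
    push_cast
    ring
  rw [hMk] at hU hmom
  have h2k : (2 : ℝ) ≤ 2 ^ k := le_self_pow₀ (by norm_num) hk.ne'
  set u := #U with hu
  have hun : 16 * n ≤ u := by
    have h1 : (16 * n : ℝ) ^ k ≤ (u : ℝ) ^ k := by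
      have h2 : (32 * n : ℝ) ^ k = 2 ^ k * (16 * n : ℝ) ^ k := by
        rw [← mul_pow]
        ring
      have h3 : (0 : ℝ) ≤ (16 * n : ℝ) ^ k := by positivity
      nlinarith
    have h2 := le_of_pow_le_pow_left₀ hk.ne' (by positivity) h1
    exact_mod_cast h2
  have hUc : Fintype.card U = u := by simp [hu]
  let d : (Fin k → V) → ℝ := fun S => #(commonNbrs R S)
  let D : ℕ := u.descFactorial n
  have hD : 0 < D := Nat.descFactorial_pos.2 (by omega)
  have hcardE : #(univ : Finset (α ↪ U)) = D := by
    rw [card_univ, Fintype.card_embedding_eq, hUc, hα]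
  have hinj : ∑ S : Fin k ↪ U, (d fun i => S i)⁻¹ ^ k ≤
      ∑ S ∈ Fintype.piFinset fun _ : Fin k => U, (d S)⁻¹ ^ k := by
    let ψ : (Fin k ↪ U) ↪ (Fin k → V) :=
      ⟨fun S i => S i, fun S S' h => by
        ext i
        exact congrFun h i⟩
    calc _ = ∑ S ∈ univ.map ψ, (d S)⁻¹ ^ k := by rw [sum_map]; rfl
      _ ≤ _ := by
        refine sum_le_sum_of_subset_of_nonneg ?_ fun S _ _ => by positivity
        intro S hS
        obtain ⟨S, -, rfl⟩ := mem_map.1 hS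
        rw [Fintype.mem_piFinset]
        exact fun i => (S i).2
  have hmoment : ∀ b, ∑ f : α ↪ U, (d fun i => f (e b i))⁻¹ ^ k ≤ D * (1 / n : ℝ) ^ k := by
    intro b
    have h1 := sum_embedding_comp (U := U) (e b) fun S => (d fun i => S i)⁻¹ ^ k
    simp only [Embedding.trans_apply] at h1
    rw [h1, hUc, hα, Fintype.card_fin]
    let c := (u - k).descFactorial (n - k)
    have hcD : c * u.descFactorial k = D := Nat.descFactorial_mul_descFactorial hkn
    have hlow : (u : ℝ) ^ k ≤ 2 ^ k * (u.descFactorial k : ℝ) := by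
      have h2 : u ^ k ≤ (2 * (u + 1 - k)) ^ k := Nat.pow_le_pow_left (by omega) k
      have h3 := Nat.pow_sub_le_descFactorial u k
      rw [mul_pow] at h2
      exact_mod_cast h2.trans (Nat.mul_le_mul_left _ h3)
    have htotal_nonneg : 0 ≤ ∑ S : Fin k ↪ U, (d fun i => S i)⁻¹ ^ k :=
      sum_nonneg fun S _ => by positivity
    generalize ∑ S : Fin k ↪ U, (d fun i => S i)⁻¹ ^ k = total at *
    have hmain : (n : ℝ) ^ k * total ≤ u.descFactorial k :=
      pow_mul_le_of_moment_le hk hn'.le htotal_nonneg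
        ((mul_le_mul_of_nonneg_left hinj (pow_nonneg (by linarith) k)).trans hmom) hlow
    rw [← hcD, one_div, inv_pow, ← div_eq_mul_inv, le_div_iff₀ (pow_pos hn' k), mul_assoc,
      mul_comm total, Nat.cast_mul]
    exact mul_le_mul_of_nonneg_left hmain (Nat.cast_nonneg c)
  have hfirst : ∀ b, ∑ f : α ↪ U, (d fun i => f (e b i))⁻¹ ≤ D * (1 / n : ℝ) := by
    intro b
    obtain ⟨m, rfl⟩ : ∃ m, k = m + 1 := ⟨k - 1, by omega⟩
    have h1 := pow_sum_le_card_pow_mul_sum_pow univ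
      (fun f : α ↪ U => (d fun i => f (e b i))⁻¹) (fun _ _ => by positivity) m
    rw [hcardE] at h1
    have h2 : (D : ℝ) ^ m * ∑ f : α ↪ U, (d fun i => f (e b i))⁻¹ ^ (m + 1) ≤
        (D * (1 / n : ℝ)) ^ (m + 1) := by
      rw [mul_pow, pow_succ (D : ℝ), mul_assoc]
      exact mul_le_mul_of_nonneg_left (hmoment b) (by positivity)
    exact le_of_pow_le_pow_left₀ (by omega) (by positivity) (h1.trans h2)
  obtain ⟨f, -, hf⟩ : ∃ f ∈ (univ : Finset (α ↪ U)),
      ∑ b, (d fun i => f (e b i))⁻¹ ≤ 1 := by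
    refine exists_le_of_sum_le (card_pos.1 (hcardE ▸ hD)) ?_
    rw [sum_comm, sum_const, hcardE, nsmul_one]
    calc _ ≤ ∑ b : α, D * (1 / n : ℝ) := sum_le_sum fun b _ => hfirst b
      _ = D := by
        rw [sum_const, card_univ, hα, nsmul_eq_mul]
        field_simp
  obtain ⟨h, hh, hmem⟩ := exists_injective_of_sum_inv_card_le_one
    (fun b => commonNbrs R fun i => (f (e b i) : V)) (fun b => hne _ fun i => (f (e b i)).2) hf
  exact ⟨fun a => f a, h, Subtype.val_injective.comp f.injective, hh,
    fun b i => (mem_commonNbrs R).1 (hmem b) i⟩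

end CommonNeighbors

end BipartiteRamsey


/-- **Ramsey numbers of bounded-degree bipartite graphs.**
For every bipartite graph `H` on `n` vertices with maximum degree `Δ`,
`r(H) ≤ 2^{Δ+6} · n`: for every `N ≥ 2^{Δ+6} · n`, every red/blue coloring of the edges
of `K_N` contains a monochromatic copy of `H`. -/
theorem stmt12 {α : Type*} [Fintype α] (Δ n : ℕ) (H : SimpleGraph α)
    (hn : Fintype.card α = n) (A : Finset α)
    (hbip : ∀ u v, H.Adj u v → (u ∈ A ↔ v ∉ A))
    (hdeg : ∀ v, (H.neighborSet v).ncard ≤ Δ) :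
    ∀ N : ℕ, 2 ^ (Δ + 6) * n ≤ N →
      ∀ c : Sym2 (Fin N) → Bool, ∃ (b : Bool) (φ : α → Fin N),
        Function.Injective φ ∧ ∀ u v, H.Adj u v → c s(φ u, φ v) = b := by
  classical
  intro N hN c
  set k := min Δ n with hk
  have hdegk : ∀ v, #(H.neighborFinset v) ≤ k := by
    intro v
    refine le_min ?_ (hn ▸ card_le_univ _)
    have := hdeg v
    rwa [← SimpleGraph.coe_neighborFinset, Set.ncard_coe_finset] at this
  have hkΔ : 2 ^ (k + 6) * n ≤ 2 ^ (Δ + 6) * n := by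
    gcongr
    · norm_num
    · exact min_le_left _ _
  have hkn : k ≤ n := min_le_right _ _
  rcases Nat.eq_zero_or_pos k with hk0 | hk0
  · have hnN : n ≤ N := by
      have : 1 * n ≤ 2 ^ (Δ + 6) * n := Nat.mul_le_mul_right n Nat.one_le_two_pow
      omega
    obtain ⟨φ⟩ : Nonempty (α ↪ Fin N) :=
      Embedding.nonempty_of_card_le (by rw [hn, Fintype.card_fin]; exact hnN)
    refine ⟨true, φ, φ.injective, fun u v huv => ?_⟩
    have h1 : 0 < #(H.neighborFinset u) := card_pos.2 ⟨v, by simpa using huv⟩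
    have h2 := hdegk u
    omega
  have he : ∀ b, ∃ e : Fin k ↪ α, ∀ a, H.Adj b a → a ∈ Set.range e := by
    intro b
    obtain ⟨t, ht, htk⟩ := exists_superset_card_eq (hdegk b) (hn ▸ hkn)
    refine ⟨(t.equivFinOfCardEq htk).symm.toEmbedding.trans (Embedding.subtype _), ?_⟩
    intro a ha
    exact ⟨t.equivFinOfCardEq htk ⟨a, ht (by simpa using ha)⟩, by simp⟩
  choose e he using he
  set M := 2 ^ (k + 5) * n with hM
  have hMN : M + M ≤ N := by
    have : 2 ^ (k + 6) * n = M + M := by rw [hM]; ring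
    omega
  let p : Fin M → Fin N := fun i => ⟨i, by omega⟩
  let q : Fin M → Fin N := fun i => ⟨M + i, by omega⟩
  obtain ⟨b, hb⟩ : ∃ b : Bool,
      M ^ 2 ≤ 2 * #{x : Fin M × Fin M | c s(p x.1, q x.2) = b} := by
    by_contra! hcon
    have h1 := hcon true
    have h2 := hcon false
    have h3 := card_filter_add_card_filter_not (s := (univ : Finset (Fin M × Fin M)))
      (fun x => c s(p x.1, q x.2) = true)
    simp only [Bool.not_eq_true, card_univ, Fintype.card_prod, Fintype.card_fin] at h3
    rw [← sq] at h3
    omega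
  obtain ⟨f, h, hf, hh, hfh⟩ := BipartiteRamsey.exists_embedding_of_density
    (fun i j : Fin M => c s(p i, q j) = b) k n M hk0 hkn hn rfl (by simp) (by simp)
    (by convert hb) e
  have hfh' : ∀ u v, H.Adj u v → c s(p (f v), q (h u)) = b := by
    intro u v huv
    obtain ⟨i, rfl⟩ := he u v huv
    exact hfh u i
  refine ⟨b, fun a => if a ∈ A then p (f a) else q (h a), ?_, ?_⟩
  · intro x y hxy
    by_cases hx : x ∈ A <;> by_cases hy : y ∈ A <;>
      simp only [hx, hy, if_true, if_false, p, q, Fin.mk.injEq] at hxy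
    · exact hf (Fin.ext hxy)
    · omega
    · omega
    · exact hh (Fin.ext (by omega))
  · intro u v huv
    have h1 := hbip u v huv
    by_cases hu : u ∈ A
    · have hv := h1.1 hu
      simp only [hu, hv, if_true, if_false]
      exact hfh' v u huv.symm
    · have hv : v ∈ A := by tauto
      simp only [hu, hv, if_true, if_false]
      rw [Sym2.eq_swap]
      exact hfh' u v huv
end
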